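/- Let S be the zero locus in A^3(K) of a polynomial of total degree 3 with coefficients in F_q whose projective closure is an absolutely irreducible cubic surface with only finitely many singular points and which is not a cone over a smooth absolutely irreducible plane cubic curve. If S has a singular F_q-rational point P, then the number of F_q-rational points of S is at most q^2 + 6(q-1) = q^2 + 6q - 6. -/

import Mathlib

noncomputable section

open MvPolynomial

variable (Fq : Type) [Field Fq] [Fintype Fq]

/-- `Kbar Fq` is a fixed algebraic closure of the finite field `Fq`. -/
abbrev Kbar : Type _ := AlgebraicClosure Fq

/-- The projective space `P^3` over the algebraic closure of `Fq`. -/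
abbrev P3 : Type _ := Projectivization (Kbar Fq) (Fin 4 → Kbar Fq)

variable {Fq}

/-- The zero locus in `P^3(K)` of a (homogeneous) polynomial. -/
def projZeros (F : MvPolynomial (Fin 4) (Kbar Fq)) : Set (P3 Fq) :=
  {p | eval p.rep F = 0}

/-- A point is singular for `F` if `F` and all four partial derivatives vanish there. -/
def IsSingularAt (F : MvPolynomial (Fin 4) (Kbar Fq)) (p : P3 Fq) : Prop :=
  eval p.rep F = 0 ∧ ∀ i, eval p.rep (pderiv i F) = 0

/-- A projective point is `F_q`-rational (`q = Fintype.card Fq`) if it has a representative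
all of whose coordinates lie in the subfield `F_q = {x | x ^ q = x}` of the closure. -/
def IsRatPoint (q : ℕ) (p : P3 Fq) : Prop :=
  ∃ (v : Fin 4 → Kbar Fq) (hv : v ≠ 0),
    Projectivization.mk (Kbar Fq) v hv = p ∧ ∀ i, v i ^ q = v i

/-- The projective line through two points (given via representatives). -/
def lineThrough (p r : P3 Fq) : Set (P3 Fq) :=
  {s | ∃ (a b : Kbar Fq) (h : a • p.rep + b • r.rep ≠ 0),
      s = Projectivization.mk (Kbar Fq) (a • p.rep + b • r.rep) h}

/-- `S = projZeros F` is a cone, with some vertex `P` not lying on a plane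
`H = {∑ cᵢ xᵢ = 0}`, over the plane curve `C = S ∩ H`, and `C` is a smooth absolutely
irreducible plane cubic: parametrizing `H` by an injective linear map given by the matrix
`M`, the pullback `G` of `F` is irreducible over the algebraic closure and has no
singular point. -/
def IsConeOverSmoothCubic (F : MvPolynomial (Fin 4) (Kbar Fq)) : Prop :=
  ∃ (P : P3 Fq) (c : Fin 4 → Kbar Fq) (M : Matrix (Fin 4) (Fin 3) (Kbar Fq)),
    c ≠ 0 ∧
    (∑ i, c i * P.rep i) ≠ 0 ∧
    Function.Injective M.mulVec ∧
    (∀ w : Fin 3 → Kbar Fq, ∑ i, c i * M.mulVec w i = 0) ∧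
    projZeros F =
      (⋃ Q ∈ projZeros F ∩ {x : P3 Fq | ∑ i, c i * x.rep i = 0}, lineThrough P Q) ∧
    Irreducible (aeval (fun i => ∑ j, C (M i j) * X j) F : MvPolynomial (Fin 3) (Kbar Fq)) ∧
    ∀ w : Fin 3 → Kbar Fq, w ≠ 0 →
      ¬(eval w (aeval (fun i => ∑ j, C (M i j) * X j) F :
            MvPolynomial (Fin 3) (Kbar Fq)) = 0 ∧
        ∀ k, eval w (pderiv k (aeval (fun i => ∑ j, C (M i j) * X j) F :
            MvPolynomial (Fin 3) (Kbar Fq))) = 0)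


set_option linter.unusedVariables false
set_option linter.unusedSimpArgs false
set_option linter.unusedSectionVars false

section CubAlg
variable {k : Type*} [Field k]

lemma cub_hom1 {p : MvPolynomial (Fin 3) k} (hp : p.IsHomogeneous 1) :
    ∃ a b c : k, p = C a * X 0 + C b * X 1 + C c * X 2 := by
  have h : p ∈ homogeneousSubmodule (Fin 3) k 1 := hp
  rw [homogeneousSubmodule_one_eq_span_X] at h
  induction h using Submodule.span_induction with
  | mem x hx =>
    obtain ⟨i, rfl⟩ := hx
    fin_cases i
    · exact ⟨1, 0, 0, by simp⟩
    · exact ⟨0, 1, 0, by simp⟩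
    · exact ⟨0, 0, 1, by simp⟩
  | zero => exact ⟨0, 0, 0, by simp⟩
  | add x y hx hy ihx ihy =>
    have hs : ∀ z ∈ Submodule.span k (Set.range (X : Fin 3 → MvPolynomial (Fin 3) k)),
        z.IsHomogeneous 1 := fun z hz => by
      rw [← homogeneousSubmodule_one_eq_span_X] at hz; exact hz
    obtain ⟨a, b, c, rfl⟩ := ihx (hs _ hx)
    obtain ⟨a', b', c', rfl⟩ := ihy (hs _ hy)
    exact ⟨a + a', b + b', c + c', by simp only [C_add]; ring⟩
  | smul r x hx ihx =>
    have hs : ∀ z ∈ Submodule.span k (Set.range (X : Fin 3 → MvPolynomial (Fin 3) k)),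
        z.IsHomogeneous 1 := fun z hz => by
      rw [← homogeneousSubmodule_one_eq_span_X] at hz; exact hz
    obtain ⟨a, b, c, rfl⟩ := ihx (hs _ hx)
    exact ⟨r * a, r * b, r * c, by simp only [C_mul, smul_eq_C_mul]; ring⟩

/-- An explicit ternary quadratic form. -/
def quad3 (a b c d e f : k) : MvPolynomial (Fin 3) k :=
  C a * X 0 ^ 2 + C b * X 1 ^ 2 + C c * X 2 ^ 2 + C d * (X 1 * X 2) + C e * (X 0 * X 2)
    + C f * (X 0 * X 1)

/-- An explicit ternary cubic form. -/
def cubic3 (a b c d e f g h i j : k) : MvPolynomial (Fin 3) k :=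
  C a * X 0 ^ 3 + C b * X 1 ^ 3 + C c * X 2 ^ 3 + C d * (X 0 ^ 2 * X 1) + C e * (X 0 ^ 2 * X 2)
    + C f * (X 1 ^ 2 * X 0) + C g * (X 1 ^ 2 * X 2) + C h * (X 2 ^ 2 * X 0)
    + C i * (X 2 ^ 2 * X 1) + C j * (X 0 * X 1 * X 2)

lemma eval_quad3 (a b c d e f : k) (v : Fin 3 → k) : eval v (quad3 a b c d e f) =
    a * v 0 ^ 2 + b * v 1 ^ 2 + c * v 2 ^ 2 + d * (v 1 * v 2) + e * (v 0 * v 2)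
    + f * (v 0 * v 1) := by
  simp [quad3]

lemma eval_cubic3 (a b c d e f g h i j : k) (v : Fin 3 → k) :
    eval v (cubic3 a b c d e f g h i j) =
    a * v 0 ^ 3 + b * v 1 ^ 3 + c * v 2 ^ 3 + d * (v 0 ^ 2 * v 1) + e * (v 0 ^ 2 * v 2)
    + f * (v 1 ^ 2 * v 0) + g * (v 1 ^ 2 * v 2) + h * (v 2 ^ 2 * v 0)
    + i * (v 2 ^ 2 * v 1) + j * (v 0 * v 1 * v 2) := by
  simp [cubic3]

lemma cub_hom2 {p : MvPolynomial (Fin 3) k} (hp : p.IsHomogeneous 2) :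
    ∃ a b c d e f : k, p = quad3 a b c d e f := by
  have h : p ∈ homogeneousSubmodule (Fin 3) k 2 := hp
  rw [← homogeneousSubmodule_one_pow, pow_two] at h
  clear hp
  induction h using Submodule.mul_induction_on' with
  | mem_mul_mem m hm n hn =>
    obtain ⟨a, b, c, rfl⟩ := cub_hom1 hm
    obtain ⟨a', b', c', rfl⟩ := cub_hom1 hn
    refine ⟨a * a', b * b', c * c', b * c' + c * b', a * c' + c * a', a * b' + b * a', ?_⟩
    simp only [quad3, C_add, C_mul]; ring
  | add x hx y hy ihx ihy =>
    obtain ⟨a, b, c, d, e, f, rfl⟩ := ihx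
    obtain ⟨a', b', c', d', e', f', rfl⟩ := ihy
    refine ⟨a + a', b + b', c + c', d + d', e + e', f + f', ?_⟩
    simp only [quad3, C_add]; ring

lemma cub_hom3 {p : MvPolynomial (Fin 3) k} (hp : p.IsHomogeneous 3) :
    ∃ a b c d e f g h i j : k, p = cubic3 a b c d e f g h i j := by
  have h : p ∈ homogeneousSubmodule (Fin 3) k 3 := hp
  rw [← homogeneousSubmodule_one_pow, pow_succ, homogeneousSubmodule_one_pow] at h
  clear hp
  induction h using Submodule.mul_induction_on' with
  | mem_mul_mem m hm n hn =>
    obtain ⟨a, b, c, d, e, f, rfl⟩ := cub_hom2 hm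
    obtain ⟨x, y, z, rfl⟩ := cub_hom1 hn
    refine ⟨a * x, b * y, c * z, a * y + f * x, a * z + e * x, b * x + f * y, b * z + d * y,
      c * x + e * z, c * y + d * z, d * x + e * y + f * z, ?_⟩
    simp only [quad3, cubic3, C_add, C_mul]; ring
  | add x hx y hy ihx ihy =>
    obtain ⟨a, b, c, d, e, f, g, h, i, j, rfl⟩ := ihx
    obtain ⟨a', b', c', d', e', f', g', h', i', j', rfl⟩ := ihy
    refine ⟨a + a', b + b', c + c', d + d', e + e', f + f', g + g', h + h', i + i', j + j', ?_⟩
    simp only [cubic3, C_add]; ring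

/-- Linear change of variables. -/
def lsub (M : Matrix (Fin 3) (Fin 3) k) : MvPolynomial (Fin 3) k →ₐ[k] MvPolynomial (Fin 3) k :=
  aeval (fun i => ∑ j, C (M i j) * X j)

/-- The linear form with given coefficients. -/
def lform (l : Fin 3 → k) : MvPolynomial (Fin 3) k := ∑ j, C (l j) * X j

lemma eval_lform (l v : Fin 3 → k) : eval v (lform l) = l ⬝ᵥ v := by
  simp [lform, dotProduct]

lemma lform_hom (l : Fin 3 → k) : (lform l).IsHomogeneous 1 :=
  IsHomogeneous.sum _ _ _ fun i _ => isHomogeneous_C_mul_X _ _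

lemma lsub_X (M : Matrix (Fin 3) (Fin 3) k) (i : Fin 3) : lsub M (X i) = lform (M i) := by
  simp [lsub, lform]

lemma lsub_lform (M : Matrix (Fin 3) (Fin 3) k) (l : Fin 3 → k) :
    lsub M (lform l) = lform (Matrix.vecMul l M) := by
  simp only [lform, map_sum, map_mul, lsub_X]
  simp only [lform, Matrix.vecMul, dotProduct, Finset.mul_sum, map_sum, Finset.sum_mul]
  rw [Finset.sum_comm]
  refine Finset.sum_congr rfl fun i _ => Finset.sum_congr rfl fun j _ => ?_
  simp [lsub, algHom_C]
  ring

lemma lsub_lsub {M N : Matrix (Fin 3) (Fin 3) k} (h : M * N = 1) (p : MvPolynomial (Fin 3) k) :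
    lsub N (lsub M p) = p := by
  have : (lsub N).comp (lsub M) = AlgHom.id k _ := by
    apply algHom_ext
    intro i
    simp only [AlgHom.comp_apply, lsub_X, lsub_lform, AlgHom.id_apply]
    have : Matrix.vecMul (M i) N = (M * N) i := by
      ext j; simp [Matrix.vecMul, Matrix.mul_apply, dotProduct]
    rw [this, h]
    simp [lform, Matrix.one_apply]
  exact congrArg (fun φ => φ p) this

lemma eval_lsub (M : Matrix (Fin 3) (Fin 3) k) (p : MvPolynomial (Fin 3) k) (v : Fin 3 → k) :
    eval v (lsub M p) = eval (M.mulVec v) p := by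
  rw [lsub, ← coe_aeval_eq_eval, ← coe_aeval_eq_eval]
  have : ((aeval v).comp (aeval (fun i => ∑ j, C (M i j) * X j)) :
      MvPolynomial (Fin 3) k →ₐ[k] k) = aeval (M.mulVec v) := by
    apply algHom_ext
    intro i
    simp [Matrix.mulVec, dotProduct]
  exact congrArg (fun φ => φ p) this

lemma lsub_hom (M : Matrix (Fin 3) (Fin 3) k) {p : MvPolynomial (Fin 3) k} {n : ℕ}
    (hp : p.IsHomogeneous n) : (lsub M p).IsHomogeneous n := by
  have := hp.aeval (fun i => ∑ j, C (M i j) * X j) (n := 1)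
    (fun i => lform_hom (M i))
  rw [one_mul] at this; exact this

lemma hom_not_unit {p : MvPolynomial (Fin 3) k} {n : ℕ} (hn : n ≠ 0)
    (hp : p.IsHomogeneous n) : ¬ IsUnit p := by
  intro h
  have h0 : p ≠ 0 := h.ne_zero
  have := hp.totalDegree h0
  rw [isUnit_iff_totalDegree_of_isReduced] at h
  omega

lemma lform_ne_zero {l : Fin 3 → k} (h : lform l ≠ 0) : l ≠ 0 := by
  rintro rfl; exact h (by simp [lform])

/-- coordinates with three given independent vectors -/
lemma exists_coord {v1 v2 v3 : Fin 3 → k} (h : LinearIndependent k ![v1, v2, v3]) :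
    ∃ M N : Matrix (Fin 3) (Fin 3) k, M * N = 1 ∧ N * M = 1 ∧
      ∀ x : Fin 3 → k, M.mulVec x = x 0 • v1 + x 1 • v2 + x 2 • v3 := by
  set M : Matrix (Fin 3) (Fin 3) k := (Matrix.of ![v1, v2, v3]).transpose with hM
  have hu : IsUnit M := by
    rw [← Matrix.linearIndependent_cols_iff_isUnit]
    simpa [hM] using h
  obtain ⟨u, hu⟩ := hu
  refine ⟨M, (↑u⁻¹ : Matrix _ _ k), by rw [← hu]; simp, by rw [← hu]; simp, fun x => ?_⟩
  ext i
  simp [hM, Matrix.mulVec, dotProduct, Fin.sum_univ_three]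
  ring

lemma eval_smul_hom {σ : Type*} {p : MvPolynomial σ k} {n : ℕ} (hp : p.IsHomogeneous n) (t : k)
    (v : σ → k) : eval (t • v) p = t ^ n * eval v p := by
  rw [eval_eq, eval_eq, Finset.mul_sum]
  refine Finset.sum_congr rfl fun d hd => ?_
  have h : ∑ i ∈ d.support, d i = n := (hp.degree_eq_sum_deg_support hd).symm
  simp only [Pi.smul_apply, smul_eq_mul, mul_pow, Finset.prod_mul_distrib]
  rw [Finset.prod_pow_eq_pow_sum, h]
  ring
end CubAlg

section CubLine
open scoped LinearAlgebra.Projectivization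
variable {k : Type*} [Field k]

lemma rep_indep {p p' : ℙ k (Fin 3 → k)} (h : p ≠ p') {s t : k}
    (e : s • p.rep + t • p'.rep = 0) : s = 0 ∧ t = 0 := by
  have := (Projectivization.linearIndependent_pair_iff_ne (D := p) (D' := p')).2 h
  exact LinearIndependent.pair_iff.1 this s t e

lemma rep_eq_of {p p' : ℙ k (Fin 3 → k)} {s : k} (e : p'.rep = s • p.rep) : p' = p := by
  by_contra h
  have := rep_indep h (s := 1) (t := -s) (by rw [e]; simp)
  simp at this

/-- Coordinates adapted to a line through two points. -/
lemma line_coord {p1 p2 : ℙ k (Fin 3 → k)} (h12 : p1 ≠ p2) {l : Fin 3 → k} (hl : l ≠ 0)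
    (h1 : l ⬝ᵥ p1.rep = 0) (h2 : l ⬝ᵥ p2.rep = 0) :
    ∃ M N : Matrix (Fin 3) (Fin 3) k, M * N = 1 ∧ N * M = 1 ∧
      (∀ x y : k, M.mulVec ![x, y, 0] = x • p1.rep + y • p2.rep) ∧
      (∃ c : k, c ≠ 0 ∧ lsub M (lform l) = C c * X 2) ∧
      (∀ v, l ⬝ᵥ v = 0 → ∃ x y : k, v = x • p1.rep + y • p2.rep) := by
  obtain ⟨v3, hv3⟩ : ∃ v3 : Fin 3 → k, l ⬝ᵥ v3 ≠ 0 := by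
    by_contra! h
    exact hl (dotProduct_eq_zero_iff.1 h)
  have hli : LinearIndependent k ![p1.rep, p2.rep, v3] := by
    rw [Fintype.linearIndependent_iff]
    intro g hg
    simp only [Fin.sum_univ_three, Matrix.cons_val_zero, Matrix.cons_val_one,
      Matrix.cons_val] at hg
    have h3 := congrArg (fun v => l ⬝ᵥ v) hg
    simp [dotProduct_add, dotProduct_smul, h1, h2, hv3] at h3
    rw [h3, zero_smul, add_zero] at hg
    have := rep_indep h12 hg
    intro i
    fin_cases i
    · exact this.1
    · exact this.2
    · exact h3
  obtain ⟨M, N, hMN, hNM, hM⟩ := exists_coord hli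
  refine ⟨M, N, hMN, hNM, fun x y => by simp [hM], ⟨l ⬝ᵥ v3, hv3, ?_⟩, fun v hv => ?_⟩
  · rw [lsub_lform]
    have e0 : Matrix.vecMul l M = ![0, 0, l ⬝ᵥ v3] := by
      have key : ∀ x, Matrix.vecMul l M ⬝ᵥ x = x 2 * (l ⬝ᵥ v3) := fun x => by
        rw [← Matrix.dotProduct_mulVec, hM]
        simp [dotProduct_add, dotProduct_smul, h1, h2]
      ext i
      have := key (Pi.single i 1)
      rw [dotProduct_single_one] at this
      rw [this]
      fin_cases i <;> simp
    rw [e0]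
    simp [lform, Fin.sum_univ_three]
  · have e : v = M.mulVec (N.mulVec v) := by simp [Matrix.mulVec_mulVec, hMN]
    set x := N.mulVec v
    rw [hM] at e
    have : x 2 = 0 := by
      rw [e] at hv
      simp [dotProduct_add, dotProduct_smul, h1, h2, hv3] at hv
      exact hv
    exact ⟨x 0, x 1, by rw [e, this]; simp⟩

lemma line2 {g : MvPolynomial (Fin 3) k} (hg : g.IsHomogeneous 2) {l : Fin 3 → k} (hl : l ≠ 0)
    (S : Finset (ℙ k (Fin 3 → k))) (hS : ∀ p ∈ S, eval p.rep g = 0 ∧ l ⬝ᵥ p.rep = 0)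
    (hc : 2 < S.card) : ∃ m : Fin 3 → k, g = lform l * lform m := by
  classical
  obtain ⟨p1, m1, p2, m2, p3, m3, h12, h13, h23⟩ := Finset.two_lt_card.1 hc
  obtain ⟨M, N, hMN, hNM, hM, ⟨c0, hc0, hlM⟩, hsp⟩ := line_coord h12 hl (hS _ m1).2 (hS _ m2).2
  obtain ⟨a, b, c, d, e, f, hq⟩ := cub_hom2 (lsub_hom M hg)
  have hev : ∀ x y : k, eval (x • p1.rep + y • p2.rep) g = a * x ^ 2 + b * y ^ 2 + f * (x * y) := by
    intro x y
    rw [← hM, ← eval_lsub, hq, eval_quad3]; simp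
  have ha : a = 0 := by have := hev 1 0; simpa [(hS _ m1).1] using this.symm
  have hb : b = 0 := by have := hev 0 1; simpa [(hS _ m2).1] using this.symm
  obtain ⟨x, y, hxy⟩ := hsp _ (hS _ m3).2
  have hx : x ≠ 0 := by rintro rfl; exact h23 (rep_eq_of (by simpa using hxy)).symm
  have hy : y ≠ 0 := by rintro rfl; exact h13 (rep_eq_of (by simpa using hxy)).symm
  have hf : f = 0 := by
    have := hev x y
    rw [← hxy, (hS _ m3).1, ha, hb] at this
    simpa [hx, hy] using this.symm
  have hX : lsub N (X 2) = C c0⁻¹ * lform l := by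
    have : lsub N (lsub M (lform l)) = lform l := lsub_lsub hMN _
    rw [hlM, map_mul] at this
    rw [← this, ← mul_assoc]
    have : lsub N (C c0) = C c0 := by simp [lsub, algHom_C]
    rw [this, ← C_mul, inv_mul_cancel₀ hc0]; simp
  refine ⟨Matrix.vecMul (c0⁻¹ • ![e, d, c]) N, ?_⟩
  rw [← lsub_lform, ← lsub_lsub hMN g, hq, ha, hb, hf]
  have : quad3 0 0 c d e 0 = X 2 * lform ![e, d, c] := by
    simp [quad3, lform, Fin.sum_univ_three]; ring
  rw [this, map_mul, hX]
  have : lform (c0⁻¹ • ![e, d, c]) = C c0⁻¹ * lform ![e, d, c] := by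
    simp [lform, Fin.sum_univ_three]; ring
  rw [this, map_mul]
  have : lsub N (C c0⁻¹) = C c0⁻¹ := by simp only [lsub, algHom_C]; rfl
  rw [this]; ring

lemma line3 {g : MvPolynomial (Fin 3) k} (hg : g.IsHomogeneous 3) {l : Fin 3 → k} (hl : l ≠ 0)
    (S : Finset (ℙ k (Fin 3 → k))) (hS : ∀ p ∈ S, eval p.rep g = 0 ∧ l ⬝ᵥ p.rep = 0)
    (hc : 3 < S.card) : lform l ∣ g := by
  classical
  obtain ⟨T, hTS, hT⟩ := Finset.exists_subset_card_eq hc.le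
  obtain ⟨p4, m4, hn4⟩ := Finset.exists_mem_notMem_of_card_lt_card (s := T) (t := S) (by omega)
  obtain ⟨p1, p2, p3, h12, h13, h23, rfl⟩ := Finset.card_eq_three.1 hT
  have m1 : p1 ∈ S := hTS (by simp)
  have m2 : p2 ∈ S := hTS (by simp)
  have m3 : p3 ∈ S := hTS (by simp)
  simp only [Finset.mem_insert, Finset.mem_singleton, not_or] at hn4
  obtain ⟨h41, h42, h43⟩ := hn4
  obtain ⟨M, N, hMN, hNM, hM, ⟨c0, hc0, hlM⟩, hsp⟩ := line_coord h12 hl (hS _ m1).2 (hS _ m2).2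
  obtain ⟨a, b, c, d, e, f, g', h, i, j, hq⟩ := cub_hom3 (lsub_hom M hg)
  have hev : ∀ x y : k, eval (x • p1.rep + y • p2.rep) g =
      a * x ^ 3 + b * y ^ 3 + d * (x ^ 2 * y) + f * (y ^ 2 * x) := by
    intro x y
    rw [← hM, ← eval_lsub, hq, eval_cubic3]; simp
  have ha : a = 0 := by have := hev 1 0; simpa [(hS _ m1).1] using this.symm
  have hb : b = 0 := by have := hev 0 1; simpa [(hS _ m2).1] using this.symm
  obtain ⟨x, y, hxy⟩ := hsp _ (hS _ m3).2
  obtain ⟨x', y', hxy'⟩ := hsp _ (hS _ m4).2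
  have hx : x ≠ 0 := by rintro rfl; exact h23 (rep_eq_of (by simpa using hxy)).symm
  have hy : y ≠ 0 := by rintro rfl; exact h13 (rep_eq_of (by simpa using hxy)).symm
  have hx' : x' ≠ 0 := by rintro rfl; exact h42 (rep_eq_of (by simpa using hxy'))
  have hy' : y' ≠ 0 := by rintro rfl; exact h41 (rep_eq_of (by simpa using hxy'))
  have hdet : x * y' - x' * y ≠ 0 := by
    intro hd
    apply h43
    apply rep_eq_of (s := x' / x)
    rw [hxy, hxy', smul_add, smul_smul, smul_smul, div_mul_cancel₀ _ hx]
    congr 2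
    field_simp
    linear_combination hd
  have E1 : d * x + f * y = 0 := by
    have := hev x y
    rw [← hxy, (hS _ m3).1, ha, hb] at this
    have h2 : (x * y) * (d * x + f * y) = 0 := by linear_combination -this
    simpa [hx, hy] using h2
  have E2 : d * x' + f * y' = 0 := by
    have := hev x' y'
    rw [← hxy', (hS _ m4).1, ha, hb] at this
    have h2 : (x' * y') * (d * x' + f * y') = 0 := by linear_combination -this
    simpa [hx', hy'] using h2
  have hd : d = 0 := by
    have : d * (x * y' - x' * y) = 0 := by linear_combination y' * E1 - y * E2
    simpa [hdet] using this
  have hf : f = 0 := by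
    have : f * (x * y' - x' * y) = 0 := by linear_combination - x' * E1 + x * E2
    simpa [hdet] using this
  have h1 : (X 2 : MvPolynomial (Fin 3) k) ∣ lsub M g := by
    rw [hq, ha, hb, hd, hf]
    refine ⟨quad3 e g' c i h j, ?_⟩
    simp [cubic3, quad3]; ring
  have h2 : lsub M (lform l) ∣ lsub M g := by
    rw [hlM]
    have hu : IsUnit (C c0 : MvPolynomial (Fin 3) k) := (IsUnit.mk0 c0 hc0).map C
    exact (hu.mul_left_dvd).2 h1
  have := map_dvd (lsub N) h2
  rwa [lsub_lsub hMN, lsub_lsub hMN] at this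
end CubLine

section CubCount
open scoped LinearAlgebra.Projectivization
open Classical
variable {k : Type*} [Field k] [Fintype k]

/-- Finiteness of the projective plane. -/
@[reducible] def fintypeP2 : Fintype (ℙ k (Fin 3 → k)) := Fintype.ofFinite _

attribute [local instance] fintypeP2

/-- rational zeros in the projective plane -/
def pz (g : MvPolynomial (Fin 3) k) : Finset (ℙ k (Fin 3 → k)) :=
  Finset.univ.filter fun p => eval p.rep g = 0

lemma mem_pz {g : MvPolynomial (Fin 3) k} {p : ℙ k (Fin 3 → k)} :
    p ∈ pz g ↔ eval p.rep g = 0 := by simp [pz]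

lemma card_P2 : Fintype.card (ℙ k (Fin 3 → k)) = Fintype.card k ^ 2 + Fintype.card k + 1 := by
  have := Projectivization.card_of_finrank k (Fin 3 → k) (n := 3) (by simp)
  rw [Nat.card_eq_fintype_card, Nat.card_eq_fintype_card] at this
  rw [this]
  simp [Finset.sum_range_succ]; ring

lemma fibre_count (a b : k) :
    (Finset.univ.filter fun t : kˣ => (t : k) ^ 2 * a + (t : k) ^ 3 * b = 0).card ≤
      (if a = 0 ∧ b = 0 then Fintype.card k - 1 else 0) + (if a ≠ 0 ∧ b ≠ 0 then 1 else 0) := by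
  have key : ∀ t : kˣ, (t : k) ^ 2 * a + (t : k) ^ 3 * b = 0 → a + t * b = 0 := by
    intro t h
    have : (t : k) ^ 2 * (a + t * b) = 0 := by linear_combination h
    simpa using this
  by_cases ha : a = 0 <;> by_cases hb : b = 0
  · simp [ha, hb, Fintype.card_units]
  · simp [ha, hb]
  · simp [ha, hb]
  · simp only [ha, hb, and_self, if_false, ne_eq, not_false_eq_true, if_true, zero_add]
    rw [Finset.card_le_one]
    intro s hs t ht
    have h1 := key s (by simpa using hs)
    have h2 := key t (by simpa using ht)
    have : ((s : k) - t) * b = 0 := by linear_combination h1 - h2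
    have := (mul_eq_zero.1 this).resolve_right hb
    exact Units.ext (sub_eq_zero.1 this)

lemma nz_bij : Function.Bijective
    (fun x : ℙ k (Fin 3 → k) × kˣ => (⟨(x.2 : k) • x.1.rep, by
      simpa using x.1.rep_nonzero⟩ : {v : Fin 3 → k // v ≠ 0})) := by
  constructor
  · rintro ⟨p, s⟩ ⟨p', t⟩ h
    simp only [Subtype.mk.injEq] at h
    have hp : p = p' := by
      by_contra hne
      have := rep_indep hne (s := s) (t := -t) (by rw [h]; simp)
      exact s.ne_zero this.1
    subst hp
    have : ((s : k) - t) • p.rep = 0 := by rw [sub_smul, h, sub_self]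
    have := (smul_eq_zero.1 this).resolve_right p.rep_nonzero
    rw [Units.ext (sub_eq_zero.1 this)]
  · rintro ⟨v, hv⟩
    obtain ⟨a, ha⟩ := Projectivization.exists_smul_eq_mk_rep k v hv
    refine ⟨(Projectivization.mk k v hv, a⁻¹), ?_⟩
    simp only [Subtype.mk.injEq, ← ha]
    rw [Units.smul_def, smul_smul]; simp

lemma count_le {g2 g3 : MvPolynomial (Fin 3) k} (h2 : g2.IsHomogeneous 2)
    (h3 : g3.IsHomogeneous 3) :
    Nat.card {x : Fin 3 → k // eval x (g2 + g3) = 0} ≤ 1 + (pz g2 ∩ pz g3).card *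
      (Fintype.card k - 1) + (Fintype.card k ^ 2 + Fintype.card k + 1 - (pz g2 ∪ pz g3).card) := by
  rw [Nat.card_eq_fintype_card, Fintype.card_subtype]
  have e1 : (Finset.univ.filter fun x : Fin 3 → k => eval x (g2 + g3) = 0) ⊆
      insert 0 ((Finset.univ.filter fun y : ℙ k (Fin 3 → k) × kˣ =>
        eval ((y.2 : k) • y.1.rep) (g2 + g3) = 0).image
          fun y => (y.2 : k) • y.1.rep) := by
    intro x hx
    by_cases h0 : x = 0
    · simp [h0]
    obtain ⟨y, hy⟩ := nz_bij.2 ⟨x, h0⟩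
    have hy' : (y.2 : k) • y.1.rep = x := congrArg Subtype.val hy
    apply Finset.mem_insert_of_mem
    refine Finset.mem_image.2 ⟨y, ?_, hy'⟩
    simp only [Finset.mem_filter, Finset.mem_univ, true_and] at hx ⊢
    rw [hy']; exact hx
  refine (Finset.card_le_card e1).trans ((Finset.card_insert_le _ _).trans ?_)
  refine (Nat.add_le_add_right Finset.card_image_le 1).trans ?_
  have e2 : (Finset.univ.filter fun y : ℙ k (Fin 3 → k) × kˣ =>
        eval ((y.2 : k) • y.1.rep) (g2 + g3) = 0).card = ∑ p : ℙ k (Fin 3 → k),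
        (Finset.univ.filter fun t : kˣ => (t : k) ^ 2 * eval p.rep g2 +
          (t : k) ^ 3 * eval p.rep g3 = 0).card := by
    simp only [Finset.card_filter]
    rw [Fintype.sum_prod_type]
    simp only [map_add, eval_smul_hom h2, eval_smul_hom h3]
  have e3 := Finset.sum_le_sum (s := Finset.univ) fun (p : ℙ k (Fin 3 → k)) _ =>
    fibre_count (eval p.rep g2) (eval p.rep g3)
  rw [← e2, Finset.sum_add_distrib, ← Finset.sum_filter, ← Finset.sum_filter, Finset.sum_const,
    Finset.sum_const] at e3
  have e4 : (Finset.univ.filter fun p : ℙ k (Fin 3 → k) => eval p.rep g2 = 0 ∧ eval p.rep g3 = 0)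
      = pz g2 ∩ pz g3 := by ext p; simp [pz]
  have e5 : (Finset.univ.filter fun p : ℙ k (Fin 3 → k) => eval p.rep g2 ≠ 0 ∧ eval p.rep g3 ≠ 0)
      = (pz g2 ∪ pz g3)ᶜ := by ext p; simp [pz]
  rw [e4, e5, Finset.card_compl, card_P2] at e3
  simp only [smul_eq_mul, mul_one] at e3
  omega

lemma bound_of {g2 g3 : MvPolynomial (Fin 3) k} (h2 : g2.IsHomogeneous 2)
    (h3 : g3.IsHomogeneous 3)
    (h : (pz g2 ∩ pz g3).card ≤ 5 ∨ ((pz g2 ∩ pz g3).card ≤ 6 ∧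
      Fintype.card k + 2 ≤ (pz g2 ∪ pz g3).card)) :
    Nat.card {x : Fin 3 → k // eval x (g2 + g3) = 0} ≤
      Fintype.card k ^ 2 + 6 * (Fintype.card k - 1) := by
  refine (count_le h2 h3).trans ?_
  have hq : 1 < Fintype.card k := Fintype.one_lt_card
  obtain ⟨n, hn⟩ := Nat.exists_eq_add_of_lt hq
  have hLU : (pz g2 ∩ pz g3).card ≤ (pz g2 ∪ pz g3).card :=
    Finset.card_le_card (Finset.inter_subset_left.trans Finset.subset_union_left)
  generalize (pz g2 ∩ pz g3).card = L at *
  generalize (pz g2 ∪ pz g3).card = U at *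
  generalize Fintype.card k = q at *
  have hqn : q - 1 = n + 1 := by omega
  rw [hqn]
  subst hn
  rcases h with h | ⟨h, hU⟩
  · interval_cases L <;> ring_nf <;> omega
  · rcases Nat.lt_or_ge L 6 with h' | h'
    · interval_cases L <;> ring_nf <;> omega
    · have : L = 6 := by omega
      subst this
      ring_nf; omega
end CubCount

section CubCase
open scoped LinearAlgebra.Projectivization
open Classical
variable {k : Type*} [Field k] [Fintype k]

attribute [local instance] fintypeP2

lemma tour4 {α : Type*} (R : α → α → Prop) (S : Finset α) (hS : 4 ≤ S.card)
    (h1 : ∀ x ∈ S, ∀ y ∈ S, x ≠ y → (R x y ∨ R y x))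
    (h2 : ∀ x ∈ S, ∀ y ∈ S, ∀ z ∈ S, x ≠ y → x ≠ z → y ≠ z → R x y → R x z → ∀ w, R x w) :
    ∃ x ∈ S, ∀ w, R x w := by
  by_contra! hcon
  have h2' : ∀ x ∈ S, ∀ y ∈ S, ∀ z ∈ S, x ≠ y → x ≠ z → y ≠ z → R x y → ¬ R x z := by
    intro x hx y hy z hz a b c d e
    obtain ⟨w, hw⟩ := hcon x hx
    exact hw (h2 x hx y hy z hz a b c d e w)
  obtain ⟨T, hTS, hT⟩ := Finset.exists_subset_card_eq (show 3 ≤ S.card by omega)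
  obtain ⟨d, md, hn4⟩ := Finset.exists_mem_notMem_of_card_lt_card (s := T) (t := S) (by omega)
  obtain ⟨a, b, c, hab, hac, hbc, rfl⟩ := Finset.card_eq_three.1 hT
  have ma : a ∈ S := hTS (by simp)
  have mb : b ∈ S := hTS (by simp)
  have mc : c ∈ S := hTS (by simp)
  simp only [Finset.mem_insert, Finset.mem_singleton, not_or] at hn4
  obtain ⟨hda, hdb, hdc⟩ := hn4
  -- two incoming arrows at `d` are impossible
  have key : ∀ x ∈ S, ∀ y ∈ S, x ≠ y → x ≠ d → y ≠ d → R x d → R y d → False := by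
    intro x hx y hy hxy hxd hyd r1 r2
    rcases h1 x hx y hy hxy with r | r
    · exact h2' x hx y hy d md hxy hxd hyd r r1
    · exact h2' y hy x hx d md hxy.symm hyd hxd r r2
  have key2 : ∀ x ∈ S, ∀ y ∈ S, x ≠ y → x ≠ d → y ≠ d → R d x → R d y → False :=
    fun x hx y hy hxy hxd hyd r1 r2 => h2' d md x hx y hy hxd.symm hyd.symm hxy r1 r2
  have hda := Ne.symm hda
  have hdb := Ne.symm hdb
  have hdc := Ne.symm hdc
  rcases h1 a ma d md hda with r | r <;> rcases h1 b mb d md hdb with r' | r' <;>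
    rcases h1 c mc d md hdc with r'' | r''
  · exact key a ma b mb hab hda hdb r r'
  · exact key a ma b mb hab hda hdb r r'
  · exact key a ma c mc hac hda hdc r r''
  · exact key2 b mb c mc hbc hdb hdc r' r''
  · exact key b mb c mc hbc hdb hdc r' r''
  · exact key2 a ma c mc hac hda hdc r r''
  · exact key2 a ma b mb hab hda hdb r r'
  · exact key2 a ma b mb hab hda hdb r r'

lemma tour5 {α : Type*} (R : α → α → Prop) (S : Finset α) (hS : 5 ≤ S.card)
    (h1 : ∀ x ∈ S, ∀ y ∈ S, x ≠ y → (R x y ∨ R y x))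
    (h1' : ∀ x ∈ S, ∀ y ∈ S, x ≠ y → ¬ (R x y ∧ R y x))
    (h2 : ∀ x ∈ S, ∀ y ∈ S, ∀ z ∈ S, x ≠ y → x ≠ z → y ≠ z → R x y → R x z → ∀ w, R x w) :
    False := by
  obtain ⟨x, hx, hxR⟩ := tour4 R S (by omega) h1 h2
  have hsub := Finset.erase_subset x S
  obtain ⟨y, hy, hyR⟩ := tour4 R (S.erase x) (by rw [Finset.card_erase_of_mem hx]; omega)
    (fun a ha b hb => h1 a (hsub ha) b (hsub hb))
    (fun a ha b hb c hc => h2 a (hsub ha) b (hsub hb) c (hsub hc))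
  exact h1' x hx y (hsub hy) (Finset.ne_of_mem_erase hy).symm ⟨hxR y, hyR x⟩

lemma polar3 {g : MvPolynomial (Fin 3) k} (hg : g.IsHomogeneous 3) :
    ∃ D : (Fin 3 → k) → (Fin 3 → k) → k,
      (∀ P Q, ∀ s t : k, eval (s • P + t • Q) g = s ^ 3 * eval P g + s ^ 2 * t * D P Q
        + s * t ^ 2 * D Q P + t ^ 3 * eval Q g) ∧
      (∀ P, D P P = 3 * eval P g) ∧ ∀ P, ∃ l : Fin 3 → k, ∀ Q, D P Q = l ⬝ᵥ Q := by
  obtain ⟨a, b, c, d, e, f, g', h, i, j, rfl⟩ := cub_hom3 hg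
  refine ⟨fun P Q => ![3 * a * P 0 ^ 2 + 2 * d * P 0 * P 1 + 2 * e * P 0 * P 2 + f * P 1 ^ 2
      + h * P 2 ^ 2 + j * P 1 * P 2,
    3 * b * P 1 ^ 2 + d * P 0 ^ 2 + 2 * f * P 1 * P 0 + 2 * g' * P 1 * P 2 + i * P 2 ^ 2
      + j * P 0 * P 2,
    3 * c * P 2 ^ 2 + e * P 0 ^ 2 + g' * P 1 ^ 2 + 2 * h * P 2 * P 0 + 2 * i * P 2 * P 1
      + j * P 0 * P 1] ⬝ᵥ Q, ?_, ?_, fun P => ⟨_, fun Q => rfl⟩⟩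
  · intro P Q s t
    simp only [eval_cubic3, dotProduct, Fin.sum_univ_three, Pi.add_apply, Pi.smul_apply,
      smul_eq_mul, Matrix.cons_val_zero, Matrix.cons_val_one, Matrix.cons_val]
    ring
  · intro P
    simp only [eval_cubic3, dotProduct, Fin.sum_univ_three, Pi.add_apply, Pi.smul_apply,
      smul_eq_mul, Matrix.cons_val_zero, Matrix.cons_val_one, Matrix.cons_val]
    ring

lemma mk_mem_pz {g : MvPolynomial (Fin 3) k} {n : ℕ} (hg : g.IsHomogeneous n)
    {v : Fin 3 → k} (hv : v ≠ 0) (h : eval v g = 0) : Projectivization.mk k v hv ∈ pz g := by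
  obtain ⟨a, ha⟩ := Projectivization.exists_smul_eq_mk_rep k v hv
  rw [mem_pz, ← ha, Units.smul_def, eval_smul_hom hg, h, mul_zero]

lemma no_arc {g : MvPolynomial (Fin 3) k} (hg : g.IsHomogeneous 3) (hc : 5 ≤ (pz g).card)
    (hli : ∀ p ∈ pz g, ∀ p' ∈ pz g, ∀ r ∈ pz g, p ≠ p' → p ≠ r → p' ≠ r →
      LinearIndependent k ![p.rep, p'.rep, r.rep]) : False := by
  obtain ⟨D, hD, hDP, hDl⟩ := polar3 hg
  have T0 : ∀ p ∈ pz g, ∀ p' ∈ pz g, p ≠ p' → ∀ s t : k, s ≠ 0 → t ≠ 0 →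
      s * D p.rep p'.rep + t * D p'.rep p.rep = 0 → False := by
    intro p hp p' hp' hne s t hs ht e
    have hv : s • p.rep + t • p'.rep ≠ 0 := fun h => hs (rep_indep hne h).1
    have h0 : eval (s • p.rep + t • p'.rep) g = 0 := by
      rw [hD, mem_pz.1 hp, mem_pz.1 hp']
      linear_combination s * t * e
    have hr := mk_mem_pz hg hv h0
    obtain ⟨a, ha⟩ := Projectivization.exists_smul_eq_mk_rep k _ hv
    rw [Units.smul_def] at ha
    set r := Projectivization.mk k _ hv
    have n1 : p ≠ r := by
      intro h
      rw [← h] at ha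
      have := rep_indep hne (s := a * s - 1) (t := a * t) (by
        rw [sub_smul, one_smul]; nth_rw 2 [← ha]; module)
      simp [ht] at this
    have n2 : p' ≠ r := by
      intro h
      rw [← h] at ha
      have := rep_indep hne (s := a * s) (t := a * t - 1) (by
        rw [sub_smul, one_smul]; nth_rw 2 [← ha]; module)
      simp [hs] at this
    have := Fintype.linearIndependent_iff.1 (hli p hp p' hp' r hr hne n1 n2) ![a * s, a * t, -1] (by
      simp [Fin.sum_univ_three, ← ha]; module) 2
    simp at this
  refine tour5 (fun p p' : ℙ k (Fin 3 → k) => D p.rep p'.rep = 0) (pz g) hc ?_ ?_ ?_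
  · intro x hx y hy hxy
    by_contra! h
    exact T0 x hx y hy hxy (D y.rep x.rep) (-D x.rep y.rep) h.2 (neg_ne_zero.2 h.1) (by ring)
  · rintro x hx y hy hxy ⟨e1, e2⟩
    exact T0 x hx y hy hxy 1 1 one_ne_zero one_ne_zero (by rw [e1, e2]; ring)
  · intro x hx y hy z hz hxy hxz hyz e1 e2 w
    obtain ⟨M, N, hMN, hNM, hM⟩ := exists_coord (hli x hx y hy z hz hxy hxz hyz)
    obtain ⟨l, hl⟩ := hDl x.rep
    have e0 := hDP x.rep
    rw [mem_pz.1 hx, mul_zero] at e0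
    have e : w.rep = M.mulVec (N.mulVec w.rep) := by simp [Matrix.mulVec_mulVec, hMN]
    rw [hM] at e
    rw [hl] at e0 e1 e2 ⊢
    rw [e]
    simp [dotProduct_add, dotProduct_smul, e0, e1, e2]
end CubCase

section CubCase2
open scoped LinearAlgebra.Projectivization
open Classical
variable {k : Type*} [Field k] [Fintype k]

attribute [local instance] fintypeP2

lemma relprime_ne {g2 g3 : MvPolynomial (Fin 3) k} 
    (h3 : g3.IsHomogeneous 3) (hr : IsRelPrime g2 g3) : g2 ≠ 0 := by
  rintro rfl
  exact hom_not_unit (by norm_num) h3 (hr (dvd_zero _) dvd_rfl)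

lemma line_le3 {g2 g3 : MvPolynomial (Fin 3) k} (h2 : g2.IsHomogeneous 2)
    (h3 : g3.IsHomogeneous 3) (hr : IsRelPrime g2 g3) {l : Fin 3 → k} (hl : l ≠ 0) :
    ((pz g2 ∩ pz g3).filter fun p => l ⬝ᵥ p.rep = 0).card ≤ 3 := by
  by_contra! hc
  obtain ⟨m, hm⟩ := line2 h2 hl ((pz g2 ∩ pz g3).filter fun p => l ⬝ᵥ p.rep = 0)
    (fun p hp => by
      simp only [Finset.mem_filter, Finset.mem_inter, mem_pz] at hp
      exact ⟨hp.1.1, hp.2⟩) (by omega)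
  have hd := line3 h3 hl ((pz g2 ∩ pz g3).filter fun p => l ⬝ᵥ p.rep = 0)
    (fun p hp => by
      simp only [Finset.mem_filter, Finset.mem_inter, mem_pz] at hp
      exact ⟨hp.1.2, hp.2⟩) hc
  exact hom_not_unit one_ne_zero (lform_hom l) (hr ⟨_, hm⟩ hd)

lemma split_le {g2 g3 : MvPolynomial (Fin 3) k} (h20 : g2 ≠ 0) {r : ℕ}
    (hle : ∀ l : Fin 3 → k, l ≠ 0 →
      ((pz g2 ∩ pz g3).filter fun p => l ⬝ᵥ p.rep = 0).card ≤ r)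
    {l m : Fin 3 → k} (hlm : g2 = lform l * lform m) : (pz g2 ∩ pz g3).card ≤ 2 * r := by
  have hl : l ≠ 0 := lform_ne_zero (by rintro h; apply h20; rw [hlm, h, zero_mul])
  have hm : m ≠ 0 := lform_ne_zero (by rintro h; apply h20; rw [hlm, h, mul_zero])
  have hsub : pz g2 ∩ pz g3 ⊆ ((pz g2 ∩ pz g3).filter fun p => l ⬝ᵥ p.rep = 0) ∪
      ((pz g2 ∩ pz g3).filter fun p => m ⬝ᵥ p.rep = 0) := by
    intro p hp
    have h := mem_pz.1 (Finset.mem_inter.1 hp).1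
    rw [hlm, map_mul, eval_lform, eval_lform, mul_eq_zero] at h
    simp only [Finset.mem_union, Finset.mem_filter, hp, true_and]
    exact h
  have h1 := Finset.card_le_card hsub
  have h2 := Finset.card_union_le ((pz g2 ∩ pz g3).filter fun p => l ⬝ᵥ p.rep = 0)
      ((pz g2 ∩ pz g3).filter fun p => m ⬝ᵥ p.rep = 0)
  have := hle l hl
  have := hle m hm
  omega

lemma caseI {g2 g3 : MvPolynomial (Fin 3) k} (h2 : g2.IsHomogeneous 2)
    (h3 : g3.IsHomogeneous 3) (hr : IsRelPrime g2 g3) {l : Fin 3 → k} (hl : l ≠ 0)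
    (hc : 2 < ((pz g2 ∩ pz g3).filter fun p => l ⬝ᵥ p.rep = 0).card) :
    (pz g2 ∩ pz g3).card ≤ 5 ∨ ((pz g2 ∩ pz g3).card ≤ 6 ∧
      Fintype.card k + 2 ≤ (pz g2 ∪ pz g3).card) := by
  obtain ⟨m, hm⟩ := line2 h2 hl ((pz g2 ∩ pz g3).filter fun p => l ⬝ᵥ p.rep = 0)
    (fun p hp => by
      simp only [Finset.mem_filter, Finset.mem_inter, mem_pz] at hp
      exact ⟨hp.1.1, hp.2⟩) hc
  have h6 := split_le (relprime_ne h3 hr) (fun l hl => line_le3 h2 h3 hr hl) hm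
  by_cases h5 : (pz g2 ∩ pz g3).card ≤ 5
  · exact Or.inl h5
  refine Or.inr ⟨h6, ?_⟩
  obtain ⟨p1, m1, p2, m2, p3, m3, h12, h13, h23⟩ := Finset.two_lt_card.1 hc
  have l1 := (Finset.mem_filter.1 m1).2
  have l2 := (Finset.mem_filter.1 m2).2
  obtain ⟨r, hrm, hrn⟩ := Finset.exists_mem_notMem_of_card_lt_card
    (s := (pz g2 ∩ pz g3).filter fun p => l ⬝ᵥ p.rep = 0) (t := pz g2 ∩ pz g3) (by
      have := line_le3 h2 h3 hr hl; omega)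
  have hrl : l ⬝ᵥ r.rep ≠ 0 := fun h => hrn (Finset.mem_filter.2 ⟨hrm, h⟩)
  have hv : ∀ t : k, p1.rep + t • p2.rep ≠ 0 := fun t h => by
    have := rep_indep h12 (s := 1) (t := t) (by rw [one_smul]; exact h)
    exact one_ne_zero this.1
  set φ : Option k → ℙ k (Fin 3 → k) := fun o => o.elim p2
    fun t => Projectivization.mk k _ (hv t) with hφ
  have hφl : ∀ o, l ⬝ᵥ (φ o).rep = 0 := by
    rintro (_ | t)
    · exact l2
    · obtain ⟨a, ha⟩ := Projectivization.exists_smul_eq_mk_rep k _ (hv t)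
      simp only [hφ, Option.elim_some]
      rw [← ha, Units.smul_def]
      simp [dotProduct_add, dotProduct_smul, l1, l2]
  have hinj : Function.Injective φ := by
    have hsn : ∀ t, φ (some t) ≠ φ none := by
      intro t h
      obtain ⟨a, ha⟩ := Projectivization.exists_smul_eq_mk_rep k _ (hv t)
      simp only [hφ, Option.elim_some, Option.elim_none] at h
      rw [h, Units.smul_def] at ha
      have := rep_indep h12 (s := a) (t := a * t - 1) (by
        rw [sub_smul, one_smul]; nth_rw 2 [← ha]; module)
      exact a.ne_zero this.1
    rintro (_ | s) (_ | t) h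
    · rfl
    · exact absurd h.symm (hsn t)
    · exact absurd h (hsn s)
    · simp only [hφ, Option.elim_some] at h
      rw [Projectivization.mk_eq_mk_iff'] at h
      obtain ⟨a, ha⟩ := h
      have := rep_indep h12 (s := a - 1) (t := a * t - s) (by
        have : a • (p1.rep + t • p2.rep) - (p1.rep + s • p2.rep) = 0 := by rw [ha, sub_self]
        rw [← this]; module)
      have e1 : a = 1 := sub_eq_zero.1 this.1
      have e2 := this.2
      rw [e1, one_mul, sub_eq_zero] at e2
      rw [e2]
  have hsub : insert r (Finset.univ.image φ) ⊆ pz g2 ∪ pz g3 := by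
    intro p hp
    rcases Finset.mem_insert.1 hp with rfl | hp
    · exact Finset.mem_union_left _ (Finset.mem_inter.1 hrm).1
    · obtain ⟨o, -, rfl⟩ := Finset.mem_image.1 hp
      apply Finset.mem_union_left
      rw [mem_pz, hm, map_mul, eval_lform, hφl, zero_mul]
  have hrn : r ∉ Finset.univ.image φ := by
    intro h
    obtain ⟨o, -, rfl⟩ := Finset.mem_image.1 h
    exact hrl (hφl o)
  have := Finset.card_le_card hsub
  rw [Finset.card_insert_of_notMem hrn, Finset.card_image_of_injective _ hinj, Finset.card_univ,
    Fintype.card_option] at this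
  omega

lemma cubic_roots {c0 c1 c2 c3 : k} (T : Finset k) (hT : 4 ≤ T.card)
    (h : ∀ t ∈ T, c0 + c1 * t + c2 * t ^ 2 + c3 * t ^ 3 = 0) :
    c0 = 0 ∧ c1 = 0 ∧ c2 = 0 ∧ c3 = 0 := by
  set p : Polynomial k := Polynomial.C c0 + Polynomial.C c1 * Polynomial.X
    + Polynomial.C c2 * Polynomial.X ^ 2 + Polynomial.C c3 * Polynomial.X ^ 3 with hp
  have hd : p.natDegree ≤ 3 := by rw [hp]; compute_degree
  have h0 : p = 0 := Polynomial.eq_zero_of_natDegree_lt_card_of_eval_eq_zero' p T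
    (fun t ht => by simpa [hp] using h t ht) (by omega)
  have hc : ∀ n, p.coeff n = 0 := by simp [h0]
  refine ⟨?_, ?_, ?_, ?_⟩
  · simpa [hp, Polynomial.coeff_X, Polynomial.coeff_C, Polynomial.coeff_X_pow] using hc 0
  · simpa [hp, Polynomial.coeff_X, Polynomial.coeff_C, Polynomial.coeff_X_pow] using hc 1
  · simpa [hp, Polynomial.coeff_X, Polynomial.coeff_C, Polynomial.coeff_X_pow] using hc 2
  · simpa [hp, Polynomial.coeff_X, Polynomial.coeff_C, Polynomial.coeff_X_pow] using hc 3

lemma li_of_le2 {S : Finset (ℙ k (Fin 3 → k))}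
    (hle : ∀ l : Fin 3 → k, l ≠ 0 → (S.filter fun p => l ⬝ᵥ p.rep = 0).card ≤ 2) :
    ∀ p ∈ S, ∀ p' ∈ S, ∀ r ∈ S, p ≠ p' → p ≠ r → p' ≠ r →
      LinearIndependent k ![p.rep, p'.rep, r.rep] := by
  intro p hp p' hp' r hr h1 h2 h3
  by_contra hli
  have hdet : (Matrix.of ![p.rep, p'.rep, r.rep]).det = 0 := by
    by_contra hd
    apply hli
    have := Matrix.linearIndependent_rows_iff_isUnit.2
      ((Matrix.isUnit_iff_isUnit_det _).2 (IsUnit.mk0 _ hd))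
    simpa using this
  obtain ⟨l, hl, hl0⟩ := Matrix.exists_mulVec_eq_zero_iff.2 hdet
  have e : ∀ i : Fin 3, ![p.rep, p'.rep, r.rep] i ⬝ᵥ l = 0 := fun i => congrFun hl0 i
  have : 2 < (S.filter fun p => l ⬝ᵥ p.rep = 0).card := by
    rw [Finset.two_lt_card]
    refine ⟨p, ?_, p', ?_, r, ?_, h1, h2, h3⟩
    · exact Finset.mem_filter.2 ⟨hp, by rw [dotProduct_comm]; exact e 0⟩
    · exact Finset.mem_filter.2 ⟨hp', by rw [dotProduct_comm]; exact e 1⟩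
    · exact Finset.mem_filter.2 ⟨hr, by rw [dotProduct_comm]; exact e 2⟩
  have := hle l hl
  omega
end CubCase2

section CubCase3
open scoped LinearAlgebra.Projectivization
open Classical
variable {k : Type*} [Field k] [Fintype k]

attribute [local instance] fintypeP2

lemma lform_X (i : Fin 3) : lform (Pi.single i 1 : Fin 3 → k) = X i := by
  simp [lform, Pi.single_apply]

/-- Algebraic heart of the Bezout bound: a cubic with the vertices of the coordinate triangle and
four further points on a smooth conic through these vertices is a multiple of the conic. -/
lemma conic_dvd {a b c d e f g h i j : k} (ha : a ≠ 0) (hb : b ≠ 0) (hc : c ≠ 0)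
    (T : Finset k) (hT : 4 ≤ T.card)
    (hroot : ∀ t ∈ T, d * (a * t + b) ^ 2 - e * c * (a * t + b) + f * t * (a * t + b) ^ 2
      - g * c * t ^ 2 * (a * t + b) + h * c ^ 2 * t + i * c ^ 2 * t ^ 2
      - j * c * t * (a * t + b) = 0) :
    quad3 0 0 0 a b c ∣ cubic3 0 0 0 d e f g h i j := by
  obtain ⟨e0, e1, e2, e3⟩ := cubic_roots (c0 := d * b ^ 2 - e * c * b)
    (c1 := 2 * d * a * b - e * c * a + f * b ^ 2 + h * c ^ 2 - j * c * b)
    (c2 := d * a ^ 2 + 2 * f * a * b - g * c * b + i * c ^ 2 - j * c * a)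
    (c3 := f * a ^ 2 - g * c * a) T hT (fun t ht => by linear_combination hroot t ht)
  have E0 : d * b = e * c := by
    have : b * (d * b - e * c) = 0 := by linear_combination e0
    exact sub_eq_zero.1 ((mul_eq_zero.1 this).resolve_left hb)
  have E3 : f * a = g * c := by
    have : a * (f * a - g * c) = 0 := by linear_combination e3
    exact sub_eq_zero.1 ((mul_eq_zero.1 this).resolve_left ha)
  have E1 : d * a * b + f * b ^ 2 + h * c ^ 2 - j * c * b = 0 := by
    linear_combination e1 - a * E0
  have E2 : d * a ^ 2 + f * a * b + i * c ^ 2 - j * c * a = 0 := by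
    linear_combination e2 - b * E3
  have E4 : h * a = i * b := by
    have : c ^ 2 * (h * a - i * b) = 0 := by linear_combination a * E1 - b * E2
    exact sub_eq_zero.1 ((mul_eq_zero.1 this).resolve_left (pow_ne_zero 2 hc))
  have he : e = b * (d / c) := by field_simp; linear_combination -E0
  have hg : g = a * (f / c) := by field_simp; linear_combination -E3
  have hi : i = a * (h / b) := by field_simp; linear_combination -E4
  have hj : j = a * (d / c) + b * (f / c) + c * (h / b) := by
    field_simp; linear_combination -E1
  have hd : d = c * (d / c) := by field_simp
  have hf : f = c * (f / c) := by field_simp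
  have hh : h = b * (h / b) := by field_simp
  refine ⟨C (d / c) * X 0 + C (f / c) * X 1 + C (h / b) * X 2, ?_⟩
  generalize d / c = x at *
  generalize f / c = y at *
  generalize h / b = z at *
  subst hj he hg hi hd hf hh
  simp only [cubic3, quad3, C_add, C_mul, C_0]
  ring

lemma caseII {g2 g3 : MvPolynomial (Fin 3) k} (h2 : g2.IsHomogeneous 2)
    (h3 : g3.IsHomogeneous 3) (hr : IsRelPrime g2 g3)
    (hle : ∀ l : Fin 3 → k, l ≠ 0 →
      ((pz g2 ∩ pz g3).filter fun p => l ⬝ᵥ p.rep = 0).card ≤ 2)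
    (h5 : 5 < (pz g2 ∩ pz g3).card) :
    (pz g2 ∩ pz g3).card ≤ 6 ∧ Fintype.card k + 2 ≤ (pz g2 ∪ pz g3).card := by
  have hli := li_of_le2 hle
  obtain ⟨p1, m1, p2, m2, p3, m3, h12, h13, h23⟩ :=
    Finset.two_lt_card.1 (show 2 < (pz g2 ∩ pz g3).card by omega)
  have hli3 := hli _ m1 _ m2 _ m3 h12 h13 h23
  obtain ⟨M, N, hMN, hNM, hM⟩ := exists_coord hli3
  obtain ⟨a1, a2, a3, a, b, c, hq2⟩ := cub_hom2 (lsub_hom M h2)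
  obtain ⟨b1, b2, b3, d, e, f, g, h, i, j, hq3⟩ := cub_hom3 (lsub_hom M h3)
  have ev2 : ∀ x : Fin 3 → k, eval (x 0 • p1.rep + x 1 • p2.rep + x 2 • p3.rep) g2 =
      eval x (quad3 a1 a2 a3 a b c) := fun x => by
    rw [← hM, ← eval_lsub, hq2]
  have ev3 : ∀ x : Fin 3 → k, eval (x 0 • p1.rep + x 1 • p2.rep + x 2 • p3.rep) g3 =
      eval x (cubic3 b1 b2 b3 d e f g h i j) := fun x => by
    rw [← hM, ← eval_lsub, hq3]
  simp only [eval_quad3] at ev2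
  simp only [eval_cubic3] at ev3
  have z1 := Finset.mem_inter.1 m1
  have z2 := Finset.mem_inter.1 m2
  have z3 := Finset.mem_inter.1 m3
  simp only [mem_pz] at z1 z2 z3
  have ha1 : a1 = 0 := by have := ev2 ![1, 0, 0]; simpa [z1] using this.symm
  have ha2 : a2 = 0 := by have := ev2 ![0, 1, 0]; simpa [z2] using this.symm
  have ha3 : a3 = 0 := by have := ev2 ![0, 0, 1]; simpa [z3] using this.symm
  have hb1 : b1 = 0 := by have := ev3 ![1, 0, 0]; simpa [z1] using this.symm
  have hb2 : b2 = 0 := by have := ev3 ![0, 1, 0]; simpa [z2] using this.symm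
  have hb3 : b3 = 0 := by have := ev3 ![0, 0, 1]; simpa [z3] using this.symm
  subst ha1 ha2 ha3 hb1 hb2 hb3
  have hnp : ∀ u v : Fin 3 → k, lsub M g2 ≠ lform u * lform v := by
    intro u v huv
    have := congrArg (lsub N) huv
    rw [lsub_lsub hMN, map_mul, lsub_lform, lsub_lform] at this
    have := split_le (relprime_ne h3 hr) hle this
    omega
  have ha : a ≠ 0 := by
    rintro rfl
    apply hnp (Pi.single 0 1) ![0, c, b]
    rw [hq2, lform_X]; simp [quad3, lform, Fin.sum_univ_three]; ring
  have hb : b ≠ 0 := by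
    rintro rfl
    apply hnp (Pi.single 1 1) ![c, 0, a]
    rw [hq2, lform_X]; simp [quad3, lform, Fin.sum_univ_three]; ring
  have hc : c ≠ 0 := by
    rintro rfl
    apply hnp (Pi.single 2 1) ![b, a, 0]
    rw [hq2, lform_X]; simp [quad3, lform, Fin.sum_univ_three]; ring
  have hco : ∀ v, ∃ x y z : k, v = x • p1.rep + y • p2.rep + z • p3.rep := fun v => by
    refine ⟨N.mulVec v 0, N.mulVec v 1, N.mulVec v 2, ?_⟩
    rw [← hM]; simp [Matrix.mulVec_mulVec, hMN]
  have ev2' : ∀ x y z : k, eval (x • p1.rep + y • p2.rep + z • p3.rep) g2 =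
      a * (y * z) + b * (x * z) + c * (x * y) := fun x y z => by
    have := ev2 ![x, y, z]; simpa using this
  have ev3' : ∀ x y z : k, eval (x • p1.rep + y • p2.rep + z • p3.rep) g3 =
      d * (x ^ 2 * y) + e * (x ^ 2 * z) + f * (y ^ 2 * x) + g * (y ^ 2 * z) + h * (z ^ 2 * x)
      + i * (z ^ 2 * y) + j * (x * y * z) := fun x y z => by
    have := ev3 ![x, y, z]; simpa using this
  have hind : ∀ x y z : k, x • p1.rep + y • p2.rep + z • p3.rep = 0 → x = 0 ∧ y = 0 ∧ z = 0 := by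
    intro x y z h0
    have := Fintype.linearIndependent_iff.1 hli3 ![x, y, z] (by
      simpa [Fin.sum_univ_three] using h0)
    exact ⟨this 0, this 1, this 2⟩
  constructor
  · -- at most six common points
    by_contra! h7
    set L' := (((pz g2 ∩ pz g3).erase p1).erase p2).erase p3 with hL'
    have hcard : 4 ≤ L'.card := by
      rw [hL']
      have := Finset.pred_card_le_card_erase (s := pz g2 ∩ pz g3) (a := p1)
      have := Finset.pred_card_le_card_erase (s := (pz g2 ∩ pz g3).erase p1) (a := p2)
      have := Finset.pred_card_le_card_erase (s := ((pz g2 ∩ pz g3).erase p1).erase p2) (a := p3)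
      omega
    have hex : ∀ p ∈ L', ∃ t : k, t ≠ 0 ∧ a * t + b ≠ 0 ∧ ∃ x : k, x ≠ 0 ∧
        p.rep = x • (p1.rep + t • p2.rep + (-c * t / (a * t + b)) • p3.rep) := by
      intro p hp
      simp only [hL', Finset.mem_erase, Finset.mem_inter, mem_pz] at hp
      obtain ⟨n3, n2, n1, e2, e3⟩ := hp
      obtain ⟨x, y, z, hxyz⟩ := hco p.rep
      rw [hxyz, ev2'] at e2
      have hx : x ≠ 0 := by
        rintro rfl
        have : y = 0 ∨ z = 0 := by simpa [ha] using e2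
        rcases this with rfl | rfl
        · exact n3 (rep_eq_of (by simpa using hxyz))
        · exact n2 (rep_eq_of (by simpa using hxyz))
      have hy : y ≠ 0 := by
        rintro rfl
        have : z = 0 := by simpa [hb, hx] using e2
        subst this
        exact n1 (rep_eq_of (by simpa using hxyz))
      have hz : a * y + b * x ≠ 0 := by
        intro h0
        have : c * (x * y) = 0 := by linear_combination e2 - z * h0
        simp [hc, hx, hy] at this
      have hz' : a * (y / x) + b ≠ 0 := by
        intro h0; apply hz
        field_simp at h0
        linear_combination h0
      refine ⟨y / x, div_ne_zero hy hx, hz', x, hx, ?_⟩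
      rw [hxyz, smul_add, smul_add, smul_smul, smul_smul, mul_div_cancel₀ _ hx]
      congr 2
      have hz2 : a * (y / x) + b = (a * y + b * x) / x := by field_simp
      have e2' : z * (a * y + b * x) = -c * (x * y) := by linear_combination e2
      rw [hz2]
      generalize a * y + b * x = D at *
      field_simp
      linear_combination e2'
    choose! t ht0 ht1 x hx hpx using hex
    have hinj : Set.InjOn t (L' : Set (ℙ k (Fin 3 → k))) := by
      intro p hp p' hp' htt
      apply rep_eq_of (s := x p / x p')
      rw [hpx p hp, hpx p' hp', htt, smul_smul, div_mul_cancel₀ _ (hx p' hp')]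
    have hdvd : quad3 0 0 0 a b c ∣ cubic3 0 0 0 d e f g h i j := by
      refine conic_dvd ha hb hc (L'.image t) (by rwa [Finset.card_image_of_injOn hinj]) ?_
      intro s hs
      obtain ⟨p, hp, rfl⟩ := Finset.mem_image.1 hs
      have e3 : eval p.rep g3 = 0 := by
        simp only [hL', Finset.mem_erase, Finset.mem_inter, mem_pz] at hp
        exact hp.2.2.2.2
      rw [hpx p hp, eval_smul_hom h3] at e3
      have e4 := (mul_eq_zero.1 e3).resolve_left (pow_ne_zero 3 (hx p hp))
      have e5 := ev3' 1 (t p) (-c * t p / (a * t p + b))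
      rw [one_smul, e4] at e5
      have h1 := ht1 p hp
      have h0 := ht0 p hp
      generalize t p = s at *
      have e6 : s * (d * (a * s + b) ^ 2 - e * c * (a * s + b) + f * s * (a * s + b) ^ 2
        - g * c * s ^ 2 * (a * s + b) + h * c ^ 2 * s + i * c ^ 2 * s ^ 2
        - j * c * s * (a * s + b)) = 0 := by
        generalize a * s + b = D at *
        field_simp at e5
        linear_combination -e5
      exact (mul_eq_zero.1 e6).resolve_left h0
    rw [← hq2, ← hq3] at hdvd
    have := map_dvd (lsub N) hdvd
    rw [lsub_lsub hMN, lsub_lsub hMN] at this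
    exact hom_not_unit two_ne_zero h2 (hr dvd_rfl this)
  · -- the union is large
    obtain ⟨r, hr3, hr2⟩ : ∃ r ∈ pz g3, r ∉ pz g2 := by
      by_contra! hsub
      have heq : pz g2 ∩ pz g3 = pz g3 := Finset.inter_eq_right.2 hsub
      rw [heq] at hli h5
      exact no_arc h3 h5.le hli
    have hv : ∀ t : k, (a * t + b) • p1.rep + (t * (a * t + b)) • p2.rep + (-c * t) • p3.rep ≠ 0 := by
      intro t h0
      obtain ⟨e1, e2, e3⟩ := hind _ _ _ h0
      have : t = 0 := by simpa [hc] using e3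
      rw [this] at e1
      simp [hb] at e1
    set φ : Option k → ℙ k (Fin 3 → k) := fun o => o.elim p2
      fun t => Projectivization.mk k _ (hv t) with hφ
    have hφl : ∀ o, φ o ∈ pz g2 := by
      rintro (_ | t)
      · exact mem_pz.2 z2.1
      · refine mk_mem_pz h2 _ ?_
        rw [ev2']; ring
    have hinj : Function.Injective φ := by
      have hsn : ∀ t, φ (some t) ≠ φ none := by
        intro t h
        obtain ⟨u, hu⟩ := Projectivization.exists_smul_eq_mk_rep k _ (hv t)
        simp only [hφ, Option.elim_some, Option.elim_none] at h
        rw [h, Units.smul_def] at hu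
        obtain ⟨e1, e2, e3⟩ := hind (u * (a * t + b)) (u * (t * (a * t + b)) - 1) (u * (-c * t)) (by
          rw [sub_smul, one_smul]; nth_rw 2 [← hu]; module)
        have : t = 0 := by simpa [hc] using e3
        rw [this] at e1
        simp [hb] at e1
      rintro (_ | s) (_ | t) h
      · rfl
      · exact absurd h.symm (hsn t)
      · exact absurd h (hsn s)
      · simp only [hφ, Option.elim_some] at h
        rw [Projectivization.mk_eq_mk_iff'] at h
        obtain ⟨u, hu⟩ := h
        obtain ⟨e1, e2, e3⟩ := hind (u * (a * t + b) - (a * s + b))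
          (u * (t * (a * t + b)) - s * (a * s + b)) (u * (-c * t) - (-c * s)) (by
            rw [← sub_eq_zero] at hu
            rw [← hu]; module)
        have : s = t := by
          by_cases h0 : a * s + b = 0
          · rw [h0, sub_zero] at e1
            rcases mul_eq_zero.1 e1 with hu0 | ht
            · subst hu0
              have : s = 0 := by simpa [hc] using e3
              subst this
              simp [hb] at h0
            · have : a * (s - t) = 0 := by linear_combination h0 - ht
              exact sub_eq_zero.1 ((mul_eq_zero.1 this).resolve_left ha)
          · have : (a * s + b) * (s - t) = 0 := by linear_combination t * e1 - e2
            exact sub_eq_zero.1 ((mul_eq_zero.1 this).resolve_left h0)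
        rw [this]
    have hsub : insert r (Finset.univ.image φ) ⊆ pz g2 ∪ pz g3 := by
      intro p hp
      rcases Finset.mem_insert.1 hp with rfl | hp
      · exact Finset.mem_union_right _ hr3
      · obtain ⟨o, -, rfl⟩ := Finset.mem_image.1 hp
        exact Finset.mem_union_left _ (hφl o)
    have hrn : r ∉ Finset.univ.image φ := by
      intro h
      obtain ⟨o, -, rfl⟩ := Finset.mem_image.1 h
      exact hr2 (hφl o)
    have := Finset.card_le_card hsub
    rw [Finset.card_insert_of_notMem hrn, Finset.card_image_of_injective _ hinj, Finset.card_univ,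
      Fintype.card_option] at this
    omega

theorem main_count {g2 g3 : MvPolynomial (Fin 3) k} (h2 : g2.IsHomogeneous 2)
    (h3 : g3.IsHomogeneous 3) (hr : IsRelPrime g2 g3) :
    Nat.card {x : Fin 3 → k // eval x (g2 + g3) = 0} ≤
      Fintype.card k ^ 2 + 6 * (Fintype.card k - 1) := by
  apply bound_of h2 h3
  by_cases h5 : (pz g2 ∩ pz g3).card ≤ 5
  · exact Or.inl h5
  by_cases hle : ∀ l : Fin 3 → k, l ≠ 0 →
      ((pz g2 ∩ pz g3).filter fun p => l ⬝ᵥ p.rep = 0).card ≤ 2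
  · exact Or.inr (caseII h2 h3 hr hle (by omega))
  · push Not at hle
    obtain ⟨l, hl, hc⟩ := hle
    exact caseI h2 h3 hr hl hc
end CubCase3

section CubRed
variable {k : Type*} [Field k]

lemma rat_iff {F K : Type*} [Field F] [Fintype F] [Field K] [Algebra F K] (x : K) :
    x ^ Fintype.card F = x ↔ ∃ a : F, algebraMap F K a = x := by
  constructor
  · intro h
    have hsp : (Polynomial.X ^ Fintype.card F - Polynomial.X : Polynomial F) =
        ∏ a : F, (Polynomial.X - Polynomial.C a) := by
      have hr := FiniteField.roots_X_pow_card_sub_X F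
      have hm : (Polynomial.X ^ Fintype.card F - Polynomial.X : Polynomial F).Monic :=
        Polynomial.monic_X_pow_sub (by
          rw [Polynomial.degree_X]; exact_mod_cast Fintype.one_lt_card)
      have hc : (Polynomial.X ^ Fintype.card F - Polynomial.X : Polynomial F).roots.card =
          (Polynomial.X ^ Fintype.card F - Polynomial.X : Polynomial F).natDegree := by
        rw [hr, FiniteField.X_pow_card_sub_X_natDegree_eq F Fintype.one_lt_card]; rfl
      rw [← Polynomial.prod_multiset_X_sub_C_of_monic_of_roots_card_eq hm hc, hr]
      rfl
    have h2 := congrArg (Polynomial.aeval x) hsp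
    simp only [map_sub, map_pow, Polynomial.aeval_X, h, sub_self, map_prod,
      Polynomial.aeval_C] at h2
    obtain ⟨a, -, ha⟩ := Finset.prod_eq_zero_iff.1 h2.symm
    exact ⟨a, (sub_eq_zero.1 ha).symm⟩
  · rintro ⟨a, rfl⟩
    rw [← map_pow, FiniteField.pow_card]

lemma chain_rule {n m : ℕ} (φ : Fin n → MvPolynomial (Fin m) k) (p : MvPolynomial (Fin n) k)
    (j : Fin m) : pderiv j (aeval φ p) = ∑ i, aeval φ (pderiv i p) * pderiv j (φ i) := by
  induction p using MvPolynomial.induction_on with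
  | C a => simp [algebraMap_eq]
  | add p q hp hq => simp only [map_add, hp, hq, add_mul, Finset.sum_add_distrib]
  | mul_X p i hp =>
    simp only [map_mul, aeval_X, Derivation.leibniz, smul_eq_mul, hp, pderiv_X, map_add, add_mul,
      Finset.sum_add_distrib]
    rw [Finset.mul_sum]
    congr 1
    · rw [Finset.sum_eq_single i]
      · simp
      · intro b _ hb
        simp [Pi.single_apply, hb.symm]
      · simp
    · refine Finset.sum_congr rfl fun l _ => by ring

lemma totalDegree_translate_le {n : ℕ} (P : Fin n → k) (p : MvPolynomial (Fin n) k) :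
    (aeval (fun i => X i + C (P i)) p : MvPolynomial (Fin n) k).totalDegree ≤ p.totalDegree := by
  rw [aeval_def, eval₂_eq]
  refine (totalDegree_finsetSum _ _).trans (Finset.sup_le fun m hm => ?_)
  refine (totalDegree_mul _ _).trans ?_
  rw [algebraMap_eq, totalDegree_C, zero_add]
  refine (totalDegree_finsetProd _ _).trans (le_trans ?_ (le_totalDegree hm))
  rw [Finsupp.sum]
  refine Finset.sum_le_sum fun i _ => (totalDegree_pow _ _).trans ?_
  have : (X i + C (P i) : MvPolynomial (Fin n) k).totalDegree ≤ 1 :=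
    (totalDegree_add _ _).trans (by simp)
  nlinarith

lemma split_singular (g : MvPolynomial (Fin 3) k) (hd : g.totalDegree ≤ 3) (h0 : eval 0 g = 0)
    (h1 : ∀ i, eval 0 (pderiv i g) = 0) :
    ∃ g2 g3 : MvPolynomial (Fin 3) k, g2.IsHomogeneous 2 ∧ g3.IsHomogeneous 3 ∧ g = g2 + g3 := by
  refine ⟨homogeneousComponent 2 g, homogeneousComponent 3 g,
    homogeneousComponent_isHomogeneous _ _, homogeneousComponent_isHomogeneous _ _, ?_⟩
  have hc0 : coeff 0 g = 0 := by
    rw [← constantCoeff_eq, ← eval_zero]; exact h0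
  have hc1 : ∀ i, coeff (Finsupp.single i 1) g = 0 := by
    intro i
    have := h1 i
    rw [eval_zero, constantCoeff_eq, coeff_pderiv] at this
    simpa using this
  ext m
  rw [coeff_add, coeff_homogeneousComponent, coeff_homogeneousComponent]
  by_cases e2 : m.degree = 2
  · simp [e2]
  by_cases e3 : m.degree = 3
  · simp [e3]
  rw [if_neg e2, if_neg e3, add_zero]
  by_cases e0 : m.degree = 0
  · rw [Finsupp.degree_eq_zero_iff] at e0
    rw [e0, hc0]
  by_cases e1 : m.degree = 1
  · obtain ⟨i, rfl⟩ : ∃ i, m = Finsupp.single i 1 := by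
      rw [Finsupp.degree_eq_sum, Fin.sum_univ_three] at e1
      have h4 : m 0 = 1 ∧ m 1 = 0 ∧ m 2 = 0 ∨ m 0 = 0 ∧ m 1 = 1 ∧ m 2 = 0 ∨
          m 0 = 0 ∧ m 1 = 0 ∧ m 2 = 1 := by omega
      rcases h4 with h4 | h4 | h4
      · refine ⟨0, ?_⟩; ext i; fin_cases i <;> simp [h4]
      · refine ⟨1, ?_⟩; ext i; fin_cases i <;> simp [h4]
      · refine ⟨2, ?_⟩; ext i; fin_cases i <;> simp [h4]
    exact hc1 i
  · by_contra hne
    have := le_totalDegree (mem_support_iff.2 hne)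
    have h4 : m.degree = m.sum fun _ e => e := rfl
    omega

/-- Substitution moving the vertex to the point `(P : 1)`. -/
def sg (P : Fin 3 → k) : MvPolynomial (Fin 3) k →ₐ[k] MvPolynomial (Fin 4) k :=
  aeval ![X 0 - C (P 0) * X 3, X 1 - C (P 1) * X 3, X 2 - C (P 2) * X 3]

/-- Restriction to the plane at infinity. -/
def ta : MvPolynomial (Fin 4) k →ₐ[k] MvPolynomial (Fin 3) k := aeval ![X 0, X 1, X 2, 0]

lemma ta_sg (P : Fin 3 → k) (p : MvPolynomial (Fin 3) k) : ta (sg P p) = p := by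
  have : (ta.comp (sg P)) = AlgHom.id k _ := by
    apply algHom_ext
    intro i
    fin_cases i <;> simp [ta, sg]
  exact DFunLike.congr_fun this p

/-- coordinates of the projection from the vertex -/
def pr (P : Fin 3 → k) (v : Fin 4 → k) : Fin 3 → k :=
  ![v 0 - P 0 * v 3, v 1 - P 1 * v 3, v 2 - P 2 * v 3]

lemma eval_sg (P : Fin 3 → k) (p : MvPolynomial (Fin 3) k) (v : Fin 4 → k) :
    eval v (sg P p) = eval (pr P v) p := by
  have : (aeval v : _ →ₐ[k] k).comp (sg P) = aeval (pr P v) := by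
    apply algHom_ext
    intro i
    fin_cases i <;> simp [sg, pr]
  have := DFunLike.congr_fun this p
  simpa [coe_aeval_eq_eval] using this

lemma eval_ta (p : MvPolynomial (Fin 4) k) (w : Fin 3 → k) :
    eval w (ta p) = eval ![w 0, w 1, w 2, 0] p := by
  have : (aeval w : _ →ₐ[k] k).comp ta = aeval ![w 0, w 1, w 2, 0] := by
    apply algHom_ext
    intro i
    fin_cases i <;> simp [ta]
  have := DFunLike.congr_fun this p
  simpa [coe_aeval_eq_eval] using this

lemma eval_dehom (F : MvPolynomial (Fin 4) k) (w : Fin 3 → k) :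
    eval w (aeval ![X 0, X 1, X 2, 1] F : MvPolynomial (Fin 3) k) =
      eval ![w 0, w 1, w 2, 1] F := by
  have : (aeval w : _ →ₐ[k] k).comp (aeval ![X 0, X 1, X 2, 1] :
      MvPolynomial (Fin 4) k →ₐ[k] MvPolynomial (Fin 3) k) = aeval ![w 0, w 1, w 2, 1] := by
    apply algHom_ext
    intro i
    fin_cases i <;> simp
  have := DFunLike.congr_fun this F
  simpa [coe_aeval_eq_eval] using this

lemma F_eq [Infinite k] {F : MvPolynomial (Fin 4) k} (hhom : F.IsHomogeneous 3)
    (P : Fin 3 → k) {h2 h3 : MvPolynomial (Fin 3) k} (hh2 : h2.IsHomogeneous 2)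
    (hh3 : h3.IsHomogeneous 3)
    (hE : ∀ x : Fin 3 → k, eval ![x 0 + P 0, x 1 + P 1, x 2 + P 2, 1] F = eval x (h2 + h3)) :
    F = X 3 * sg P h2 + sg P h3 := by
  have key : X 3 * (F - (X 3 * sg P h2 + sg P h3)) = 0 := by
    apply MvPolynomial.funext
    intro v
    simp only [map_mul, eval_X, map_sub, map_add, eval_sg, map_zero]
    by_cases hw : v 3 = 0
    · simp [hw]
    have h1 := hE ((v 3)⁻¹ • pr P v)
    rw [map_add, eval_smul_hom hh2, eval_smul_hom hh3] at h1
    have hv : v = v 3 • ![((v 3)⁻¹ • pr P v) 0 + P 0, ((v 3)⁻¹ • pr P v) 1 + P 1,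
        ((v 3)⁻¹ • pr P v) 2 + P 2, 1] := by
      ext i
      fin_cases i <;> simp [pr] <;> field_simp <;> ring
    have h4 : eval v F = v 3 ^ 3 * (((v 3)⁻¹) ^ 2 * eval (pr P v) h2 +
        ((v 3)⁻¹) ^ 3 * eval (pr P v) h3) := by
      conv_lhs => rw [hv]
      rw [eval_smul_hom hhom, h1]
    rw [h4]
    field_simp
    ring
  rcases mul_eq_zero.1 key with h | h
  · exact absurd h (X_ne_zero 3)
  · exact sub_eq_zero.1 h

lemma ta_F (P : Fin 3 → k) (h2 h3 : MvPolynomial (Fin 3) k) :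
    ta (X 3 * sg P h2 + sg P h3) = h3 := by
  rw [map_add, map_mul, ta_sg, ta_sg]
  simp [ta]

lemma relprime_of {k0 : Type*} [Field k0] [Algebra k0 k] {F : MvPolynomial (Fin 4) k}
    (hirr : Irreducible F) (P : Fin 3 → k) {g2 g3 : MvPolynomial (Fin 3) k0}
    (hg2 : g2.IsHomogeneous 2) (hg3 : g3.IsHomogeneous 3) (hne : g2 ≠ 0)
    (hF : F = X 3 * sg P (map (algebraMap k0 k) g2) + sg P (map (algebraMap k0 k) g3)) :
    IsRelPrime g2 g3 := by
  intro d hd2 hd3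
  have hinj := map_injective (σ := Fin 3) (algebraMap k0 k) (algebraMap k0 k).injective
  set μ := map (σ := Fin 3) (algebraMap k0 k) with hμ
  have hdF : sg P (μ d) ∣ F := by
    rw [hF]
    exact dvd_add (Dvd.dvd.mul_left (map_dvd _ (map_dvd _ hd2)) _) (map_dvd _ (map_dvd _ hd3))
  obtain ⟨e, he⟩ := hdF
  rcases hirr.isUnit_or_isUnit he with hu | hu
  · have := hu.map (ta (k := k))
    rw [ta_sg] at this
    rw [isUnit_iff_totalDegree_of_isReduced] at this ⊢
    obtain ⟨h1, h2⟩ := this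
    rw [hμ, coeff_map] at h1
    refine ⟨?_, ?_⟩
    · rw [isUnit_iff_ne_zero] at h1 ⊢
      intro h; rw [h] at h1; simp at h1
    · rw [totalDegree_eq_zero_iff_eq_C] at h2 ⊢
      apply hinj
      rw [h2, hμ, map_C, coeff_map]
  · exfalso
    have h3d : μ g3 ∣ μ g2 := by
      have h5 := congrArg (ta (k := k)) he
      rw [hF, ta_F, map_mul, ta_sg] at h5
      rw [h5]
      have hu' : IsUnit (ta (k := k) e) := hu.map _
      exact hu'.mul_right_dvd.2 (map_dvd _ hd2)
    obtain ⟨r, hr⟩ := h3d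
    have hm2 : μ g2 ≠ 0 := fun h => hne (hinj (by rw [h, map_zero]))
    have hm3 : μ g3 ≠ 0 := fun h => hm2 (by rw [hr, h, zero_mul])
    have hr0 : r ≠ 0 := fun h => hm2 (by rw [hr, h, mul_zero])
    have := congrArg totalDegree hr
    rw [totalDegree_mul_of_isDomain hm3 hr0, (hg2.map _).totalDegree hm2,
      (hg3.map _).totalDegree hm3] at this
    omega
end CubRed

section CubCone

lemma exists_zero3 {K : Type*} [Field K] [IsAlgClosed K] {h : MvPolynomial (Fin 3) K}
    (hh : h.IsHomogeneous 3) : ∃ w : Fin 3 → K, w ≠ 0 ∧ eval w h = 0 := by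
  obtain ⟨a, b, c, d, e, f, g, h', i, j, rfl⟩ := cub_hom3 hh
  by_cases ha : a = 0
  · refine ⟨![1, 0, 0], ?_, ?_⟩
    · intro h0; simpa using congrFun h0 0
    · rw [eval_cubic3]; simp [ha]
  · obtain ⟨x, hx⟩ := IsAlgClosed.exists_root
      (Polynomial.C a * Polynomial.X ^ 3 + Polynomial.C d * Polynomial.X ^ 2 +
        Polynomial.C f * Polynomial.X + Polynomial.C b) (by
          rw [Polynomial.degree_cubic ha]; decide)
    refine ⟨![x, 1, 0], ?_, ?_⟩
    · intro h0; simpa using congrFun h0 1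
    · rw [eval_cubic3]
      simp at hx ⊢
      linear_combination hx

lemma rep_mk {K : Type*} [Field K] {n : ℕ} (v : Fin n → K) (hv : v ≠ 0) :
    ∃ a : K, a ≠ 0 ∧ (Projectivization.mk K v hv).rep = a • v := by
  obtain ⟨u, hu⟩ := Projectivization.exists_smul_eq_mk_rep K v hv
  exact ⟨u, u.ne_zero, by rw [← hu, Units.smul_def]⟩

lemma singular_of {K : Type*} [Field K] (P : Fin 3 → K) {h : MvPolynomial (Fin 3) K}
    {v : Fin 4 → K} (h1 : ∀ i, eval (pr P v) (pderiv i h) = 0) (j : Fin 4) :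
    eval v (pderiv j (sg P h)) = 0 := by
  rw [sg, chain_rule, map_sum]
  refine Finset.sum_eq_zero fun i _ => ?_
  rw [map_mul]
  have : eval v (sg P (pderiv i h)) = 0 := by rw [eval_sg, h1]
  rw [sg] at this
  rw [this, zero_mul]

lemma cone_of {F : MvPolynomial (Fin 4) (Kbar Fq)} (hhom : F.IsHomogeneous 3)
    (hirr : Irreducible F) (hfin : {p : P3 Fq | IsSingularAt F p}.Finite)
    (P : Fin 3 → Kbar Fq) {h : MvPolynomial (Fin 3) (Kbar Fq)} (hh : h.IsHomogeneous 3)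
    (hF : F = sg P h) : IsConeOverSmoothCubic F := by
  have hPne : (![P 0, P 1, P 2, 1] : Fin 4 → Kbar Fq) ≠ 0 := fun h0 => by
    simpa using congrFun h0 3
  have hta : ta F = h := by rw [hF, ta_sg]
  have hM : (aeval (fun i => ∑ j, C ((!![1, 0, 0; 0, 1, 0; 0, 0, 1; 0, 0, 0] :
      Matrix (Fin 4) (Fin 3) (Kbar Fq)) i j) * X j) F : MvPolynomial (Fin 3) (Kbar Fq)) = h := by
    rw [← hta, ta]
    congr 2
    ext1 i
    fin_cases i <;> simp [Fin.sum_univ_three]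
  have hmv : ∀ w : Fin 3 → Kbar Fq, (!![1, 0, 0; 0, 1, 0; 0, 0, 1; 0, 0, 0] :
      Matrix (Fin 4) (Fin 3) (Kbar Fq)).mulVec w = ![w 0, w 1, w 2, 0] := by
    intro w
    ext i
    fin_cases i <;> simp [Matrix.mulVec, dotProduct, Fin.sum_univ_three]
  have hc : ∀ x : Fin 4 → Kbar Fq, ∑ i, (![0, 0, 0, 1] : Fin 4 → Kbar Fq) i * x i = x 3 := by
    intro x; simp [Fin.sum_univ_four]
  obtain ⟨α, hα, hrep⟩ := rep_mk _ hPne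
  refine ⟨Projectivization.mk _ _ hPne, ![0, 0, 0, 1],
    !![1, 0, 0; 0, 1, 0; 0, 0, 1; 0, 0, 0], ?_, ?_, ?_, ?_, ?_, ?_, ?_⟩
  · intro h0; simpa using congrFun h0 3
  · rw [hc, hrep]; simpa using hα
  · intro w w' hw
    rw [hmv, hmv] at hw
    ext i
    fin_cases i
    · simpa using congrFun hw 0
    · simpa using congrFun hw 1
    · simpa using congrFun hw 2
  · intro w
    rw [hc, hmv]; simp
  · ext s
    simp only [Set.mem_iUnion, Set.mem_inter_iff, Set.mem_ofPred_eq, hc, exists_prop]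
    constructor
    · intro hs
      have hs0 : eval s.rep F = 0 := hs
      rw [hF, eval_sg] at hs0
      obtain ⟨w, hw0, hwz, β, hβ⟩ : ∃ w : Fin 3 → Kbar Fq, w ≠ 0 ∧ eval w h = 0 ∧
          ∃ β : Kbar Fq, pr P s.rep = β • w := by
        by_cases hu : pr P s.rep = 0
        · obtain ⟨w, hw0, hw⟩ := exists_zero3 hh
          exact ⟨w, hw0, hw, 0, by rw [hu, zero_smul]⟩
        · exact ⟨_, hu, hs0, 1, (one_smul _ _).symm⟩
      have hQne : (![w 0, w 1, w 2, 0] : Fin 4 → Kbar Fq) ≠ 0 := by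
        intro h0
        apply hw0
        ext i
        fin_cases i
        · simpa using congrFun h0 0
        · simpa using congrFun h0 1
        · simpa using congrFun h0 2
      obtain ⟨γ, hγ, hQrep⟩ := rep_mk _ hQne
      have hlin : (s.rep 3 / α) • (Projectivization.mk (Kbar Fq) _ hPne).rep +
          (β / γ) • (Projectivization.mk (Kbar Fq) _ hQne).rep = s.rep := by
        rw [hrep, hQrep, smul_smul, smul_smul, div_mul_cancel₀ _ hα, div_mul_cancel₀ _ hγ]
        have e0 := congrFun hβ 0
        have e1 := congrFun hβ 1
        have e2 := congrFun hβ 2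
        simp only [pr, Pi.smul_apply, smul_eq_mul, Matrix.cons_val] at e0 e1 e2
        ext i
        fin_cases i <;> simp
        · linear_combination -e0
        · linear_combination -e1
        · linear_combination -e2
      refine ⟨Projectivization.mk _ _ hQne, ⟨?_, ?_⟩, s.rep 3 / α, β / γ, ?_, ?_⟩
      · show eval (Projectivization.mk _ _ hQne).rep F = 0
        rw [hQrep, eval_smul_hom hhom, ← eval_ta, hta, hwz, mul_zero]
      · rw [hQrep]; simp
      · rw [hlin]; exact s.rep_nonzero
      · simp only [hlin, Projectivization.mk_rep]
    · rintro ⟨Q, ⟨hQ, hQ3⟩, a, b, hne, rfl⟩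
      obtain ⟨δ, hδ, hsrep⟩ := rep_mk _ hne
      show eval (Projectivization.mk _ _ hne).rep F = 0
      have hQ0 : eval Q.rep F = 0 := hQ
      rw [hF, eval_sg] at hQ0
      rw [hsrep, eval_smul_hom hhom, hF, eval_sg]
      have : pr P (a • (Projectivization.mk (Kbar Fq) _ hPne).rep + b • Q.rep) =
          b • pr P Q.rep := by
        rw [hrep]
        ext i
        fin_cases i <;> simp [pr] <;> ring
      rw [this, eval_smul_hom hh, hQ0, mul_zero, mul_zero]
  · rw [hM]
    refine ⟨fun hu => hirr.not_isUnit ?_, fun x y hxy => ?_⟩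
    · rw [hF]; exact hu.map _
    · have hi := hirr.isUnit_or_isUnit (a := sg P x) (b := sg P y) (by rw [hF, hxy, map_mul])
      rcases hi with hi | hi
      · left
        have := hi.map (ta (k := Kbar Fq))
        rwa [ta_sg] at this
      · right
        have := hi.map (ta (k := Kbar Fq))
        rwa [ta_sg] at this
  · rw [hM]
    rintro w hw0 ⟨hw, hdw⟩
    have hvne : ∀ t : Kbar Fq,
        (![w 0 + t * P 0, w 1 + t * P 1, w 2 + t * P 2, t] : Fin 4 → Kbar Fq) ≠ 0 := by
      intro t h0
      have e3 : t = 0 := by simpa using congrFun h0 3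
      subst e3
      apply hw0
      ext i
      fin_cases i
      · simpa using congrFun h0 0
      · simpa using congrFun h0 1
      · simpa using congrFun h0 2
    refine Set.infinite_of_injective_forall_mem
      (f := fun t : Kbar Fq => Projectivization.mk (Kbar Fq) _ (hvne t)) ?_ ?_ hfin
    · intro t s hts
      simp only at hts
      rw [Projectivization.mk_eq_mk_iff'] at hts
      obtain ⟨u, hu⟩ := hts
      have e0 := congrFun hu 0
      have e1 := congrFun hu 1
      have e2 := congrFun hu 2
      have e3 := congrFun hu 3
      simp only [Pi.smul_apply, smul_eq_mul, Matrix.cons_val] at e0 e1 e2 e3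
      have hu1 : u = 1 := by
        by_contra hne
        have hne' : u - 1 ≠ 0 := sub_ne_zero.2 hne
        apply hw0
        ext i
        fin_cases i
        · refine (mul_eq_zero.1 (?_ : (u - 1) * w 0 = 0)).resolve_left hne'
          linear_combination e0 - P 0 * e3
        · refine (mul_eq_zero.1 (?_ : (u - 1) * w 1 = 0)).resolve_left hne'
          linear_combination e1 - P 1 * e3
        · refine (mul_eq_zero.1 (?_ : (u - 1) * w 2 = 0)).resolve_left hne'
          linear_combination e2 - P 2 * e3
      rw [← e3, hu1, one_mul]
    · intro t
      obtain ⟨δ, hδ, hrep'⟩ := rep_mk _ (hvne t)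
      have hpr : pr P ![w 0 + t * P 0, w 1 + t * P 1, w 2 + t * P 2, t] = w := by
        ext i
        fin_cases i <;> simp [pr] <;> ring
      refine ⟨?_, fun j => ?_⟩
      · rw [hrep', eval_smul_hom hhom, hF, eval_sg, hpr, hw, mul_zero]
      · rw [hrep', eval_smul_hom hhom.pderiv, hF, singular_of P (by rw [hpr]; exact hdw), mul_zero]
end CubCone

/-- Let `f` (of total degree 3, with coefficients in `F_q`) define an
affine cubic surface in `A^3(K)` whose projective closure (defined by the homogeneous
cubic `F`, with `f` the dehomogenization of `F`) is absolutely irreducible, has only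
finitely many singular points, and is not a cone over a smooth absolutely irreducible
plane cubic.  If the affine surface has a singular `F_q`-rational point `P`, then it has
at most `q^2 + 6(q-1) = q^2 + 6q - 6` `F_q`-rational points. -/
theorem statement_4 (q : ℕ) (hq : q = Fintype.card Fq)
    (F : MvPolynomial (Fin 4) (Kbar Fq)) (hF0 : F ≠ 0) (hhom : F.IsHomogeneous 3)
    (hirr : Irreducible F)
    (hfin : {p : P3 Fq | IsSingularAt F p}.Finite)
    (hnotcone : ¬ IsConeOverSmoothCubic F)
    (f : MvPolynomial (Fin 3) (Kbar Fq))
    (hf : f = aeval ![X 0, X 1, X 2, 1] F)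
    (hfdeg : f.totalDegree = 3)
    (hcoeff : ∀ m, coeff m f ^ q = coeff m f)
    (P : Fin 3 → Kbar Fq)
    (hPrat : ∀ i, P i ^ q = P i)
    (hPsing : eval P f = 0 ∧ ∀ i, eval P (pderiv i f) = 0) :
    Nat.card {x : Fin 3 → Kbar Fq // eval x f = 0 ∧ ∀ i, x i ^ q = x i} ≤
      q ^ 2 + 6 * (q - 1) := by
  subst hq
  have hevf : ∀ w : Fin 3 → Kbar Fq, eval w f = eval ![w 0, w 1, w 2, 1] F := fun w => by
    rw [hf, eval_dehom]
  clear hf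
  have hinj : Function.Injective (algebraMap Fq (Kbar Fq)) := (algebraMap Fq (Kbar Fq)).injective
  have hinjm := map_injective (σ := Fin 3) (algebraMap Fq (Kbar Fq)) hinj
  choose P0 hP0 using fun i => (rat_iff (P i)).1 (hPrat i)
  obtain ⟨f0, rfl⟩ : f ∈ Set.range (map (algebraMap Fq (Kbar Fq))) := by
    rw [mem_range_map_iff_coeffs_subset]
    intro c hc
    obtain ⟨m, -, rfl⟩ := mem_coeffs_iff.1 hc
    exact (rat_iff _).1 (hcoeff m)
  have hev : ∀ (p : MvPolynomial (Fin 3) Fq) (x : Fin 3 → Fq),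
      eval (fun i => algebraMap Fq (Kbar Fq) (x i)) (map (algebraMap Fq (Kbar Fq)) p) =
      algebraMap Fq (Kbar Fq) (eval x p) := by
    intro p x
    rw [eval_map, eval₂_comp]
    rfl
  have hPeq : P = fun i => algebraMap Fq (Kbar Fq) (P0 i) := funext fun i => (hP0 i).symm
  set g0 : MvPolynomial (Fin 3) Fq := aeval (fun i => X i + C (P0 i)) f0 with hg0
  have hevg : ∀ (p : MvPolynomial (Fin 3) Fq) (x : Fin 3 → Fq),
      eval x (aeval (fun i => X i + C (P0 i)) p : MvPolynomial (Fin 3) Fq) =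
      eval (fun i => x i + P0 i) p := by
    intro p x
    have : (aeval x : _ →ₐ[Fq] Fq).comp (aeval (fun i => X i + C (P0 i)) :
        MvPolynomial (Fin 3) Fq →ₐ[Fq] MvPolynomial (Fin 3) Fq) =
        aeval (fun i => x i + P0 i) := by
      apply algHom_ext
      intro i
      simp
    have := DFunLike.congr_fun this p
    simpa [coe_aeval_eq_eval] using this
  have hgdeg : g0.totalDegree ≤ 3 := by
    refine (totalDegree_translate_le P0 f0).trans (le_of_eq ?_)
    simpa only [totalDegree, support_map_of_injective _ hinj] using hfdeg
  have hs0 : eval 0 g0 = 0 := by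
    rw [hg0, hevg]
    apply hinj
    rw [← hev, map_zero, ← hPsing.1, hPeq]
    simp
  have hs1 : ∀ i, eval 0 (pderiv i g0) = 0 := by
    intro i
    rw [hg0, chain_rule, map_sum]
    refine Finset.sum_eq_zero fun j _ => ?_
    rw [map_mul, hevg]
    have : eval P0 (pderiv j f0) = 0 := by
      apply hinj
      rw [← hev, map_zero, ← pderiv_map, ← hPeq, hPsing.2 j]
    simp [this]
  obtain ⟨g2, g3, hg2, hg3, hgs⟩ := split_singular g0 hgdeg hs0 hs1
  have hevK : ∀ x : Fin 3 → Kbar Fq, eval ![x 0 + P 0, x 1 + P 1, x 2 + P 2, 1] F =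
      eval x (map (algebraMap Fq (Kbar Fq)) g2 + map (algebraMap Fq (Kbar Fq)) g3) := by
    intro x
    have h1 := hevf (fun i => x i + P i)
    have h2 : (aeval x : _ →ₐ[Fq] Kbar Fq).comp (aeval (fun i => X i + C (P0 i)) :
        MvPolynomial (Fin 3) Fq →ₐ[Fq] MvPolynomial (Fin 3) Fq) =
        aeval (fun i => x i + P i) := by
      apply algHom_ext
      intro i
      simp [hP0]
    have h3 := DFunLike.congr_fun h2 f0
    rw [← h1, ← map_add, ← hgs, eval_map, eval_map, ← aeval_def, ← aeval_def, ← h3]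
    rfl
  have hF : F = _ := F_eq hhom P (hg2.map _) (hg3.map _) hevK
  have hcard : Nat.card {x : Fin 3 → Kbar Fq // eval x (map (algebraMap Fq (Kbar Fq)) f0) = 0 ∧
      ∀ i, x i ^ Fintype.card Fq = x i} ≤ Nat.card {x : Fin 3 → Fq // eval x (g2 + g3) = 0} := by
    rw [← hgs]
    refine Nat.card_le_card_of_surjective (fun x => ⟨fun i => algebraMap Fq (Kbar Fq)
      (x.1 i + P0 i), ?_, ?_⟩) ?_
    · rw [hev, ← hevg, ← hg0, x.2, map_zero]
    · intro i
      exact (rat_iff _).2 ⟨_, rfl⟩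
    · rintro ⟨x, hx, hxr⟩
      choose x0 hx0 using fun i => (rat_iff (x i)).1 (hxr i)
      have hxe : x = fun i => algebraMap Fq (Kbar Fq) (x0 i) := funext fun i => (hx0 i).symm
      subst hxe
      refine ⟨⟨fun i => x0 i - P0 i, ?_⟩, ?_⟩
      · rw [hg0, hevg]
        apply hinj
        rw [← hev, map_zero, ← hx]
        simp
      · simp
  refine hcard.trans ?_
  by_cases hz : g2 = 0
  · exfalso
    apply hnotcone
    rw [hz] at hF
    simp only [map_zero, mul_zero, zero_add] at hF
    exact cone_of hhom hirr hfin P (hg3.map _) hF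
  · exact main_count hg2 hg3 (relprime_of hirr P hg2 hg3 hz hF)
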